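/- arXiv:2110.01602 — 4 statements merged into one kernel-verified Lean document; each statement's English description precedes it below -/
import Mathlib

section
/- Let c > 0 be a constant and let (d_n) be positive integers with d_n = o(n / log n). For each n let φ = φ_n : ℝ^{n×d_n} → {±1}^n be a (possibly randomized) measurable estimator, and suppose there is a sequence ε_n → 0 such that under every instance of the two-component Gaussian mixture model with d = d_n and SNR = 2c log n, E[R(φ(X), y*)] ≤ exp(−SNR/(2 + ε_n)). Set ε = 1/√(2c log n) and define the test ψ_ε(X) = H₀ if ‖H φ(X + ε Z)‖_2²/n ≤ 2/π + 0.1 and ψ_ε(X) = H₁ otherwise, where H = X(X^T X)^† X^T and Z ∈ ℝ^{n×d_n} has i.i.d. N(0,1) entries independent of everything else. Then there is a sequence δ_n → 0 such that for the planted Boolean vector problem with d = d_n, P(ψ_ε(X) = H₁ | H₀) + sup_Q P(ψ_ε(X) = H₀ | H₁) ≤ n^{−c + δ_n}, where the supremum is over orthonormal Q ∈ ℝ^{d×d} in the definition of H₁. -/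
open MeasureTheory Real Matrix Filter
open scoped ENNReal

noncomputable section

/-- Squared Euclidean norm. -/
def sqnorm {m : ℕ} (v : Fin m → ℝ) : ℝ := ∑ i, v i ^ 2

/-- `v` is a vector of signs ±1. -/
def isSign {m : ℕ} (v : Fin m → ℝ) : Prop := ∀ i, v i = 1 ∨ v i = -1

/-- Misclassification proportion `R(a, b) = n⁻¹ min_{s = ±1} #{i : s aᵢ ≠ bᵢ}`. -/
def misclass (n : ℕ) (a b : Fin n → ℝ) : ℝ :=
  (n : ℝ)⁻¹ * min (Nat.card {i : Fin n // a i ≠ b i} : ℝ)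
                  (Nat.card {i : Fin n // -(a i) ≠ b i} : ℝ)

/-- Density of the `d`-dimensional Gaussian distribution `N(μ, S)` at `x`. -/
def gaussDensity {d : ℕ} (μ : Fin d → ℝ) (S : Matrix (Fin d) (Fin d) ℝ) (x : Fin d → ℝ) : ℝ :=
  (2 * π) ^ (-(d : ℝ) / 2) * S.det ^ (-(1 : ℝ) / 2) *
    Real.exp (-(1 / 2) * ((x - μ) ⬝ᵥ (S⁻¹ *ᵥ (x - μ))))

/-- The one-dimensional Gaussian density with mean `m` and variance `v`. -/
def g1 (m v x : ℝ) : ℝ := (2 * π * v) ^ (-(1 : ℝ) / 2) * Real.exp (-(x - m) ^ 2 / (2 * v))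

/-- The sign vector associated with `s : Fin n → Bool`. -/
def signVec {n : ℕ} (s : Fin n → Bool) : Fin n → ℝ := fun i => if s i then 1 else -1

/-- Law of a matrix with independent rows, row `i` distributed as `N(m i, S)`. -/
def rowsGaussLaw (n d : ℕ) (m : Fin n → Fin d → ℝ) (S : Matrix (Fin d) (Fin d) ℝ) :
    Measure (Fin n → Fin d → ℝ) :=
  volume.withDensity fun X => ENNReal.ofReal (∏ i, gaussDensity (m i) S (X i))

/-- Joint law of `(y⋆, X)` in the two-component symmetric Gaussian mixture model. -/
def mixtureJoint (n d : ℕ) (μ : Fin d → ℝ) (S : Matrix (Fin d) (Fin d) ℝ) :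
    Measure ((Fin n → ℝ) × (Fin n → Fin d → ℝ)) :=
  ((2 : ℝ≥0∞) ^ n)⁻¹ • ∑ s : Fin n → Bool,
    (Measure.dirac (signVec s)).prod (rowsGaussLaw n d (fun i => signVec s i • μ) S)

/-- Uniform distribution on `{±1}ⁿ`. -/
def uniformSigns (n : ℕ) : Measure (Fin n → ℝ) :=
  ((2 : ℝ≥0∞) ^ n)⁻¹ • ∑ s : Fin n → Bool, Measure.dirac (signVec s)

/-- Law of an `n × d` matrix with i.i.d. standard Gaussian entries (the `H₀` law in the
planted Boolean vector problem). -/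
def stdMatLaw (n d : ℕ) : Measure (Fin n → Fin d → ℝ) :=
  volume.withDensity fun X => ENNReal.ofReal (∏ i : Fin n, ∏ j : Fin d, g1 0 1 (X i j))

/-- The `H₁` law in the planted Boolean vector problem: `X = X̃ Q`, where
`X̃ = (y⋆, g₂, …, g_d)` has a uniform `{±1}ⁿ` first column independent of the remaining
i.i.d. standard Gaussian columns, and `Q` is a fixed orthonormal matrix. -/
def plantedLaw (n d : ℕ) (Q : Matrix (Fin d) (Fin d) ℝ) : Measure (Fin n → Fin d → ℝ) :=
  Measure.map
    (fun p : (Fin n → ℝ) × (Fin n → Fin d → ℝ) =>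
      fun i j => ∑ k : Fin d, (if (k : ℕ) = 0 then p.1 i else p.2 i k) * Q k j)
    ((uniformSigns n).prod (stdMatLaw n d))

/-- `B` is the Moore–Penrose pseudoinverse of `A`. -/
def IsMoorePenrose {m k : ℕ} (A : Matrix (Fin m) (Fin k) ℝ)
    (B : Matrix (Fin k) (Fin m) ℝ) : Prop :=
  A * B * A = A ∧ B * A * B = B ∧ (A * B)ᵀ = A * B ∧ (B * A)ᵀ = B * A

open Classical in
/-- The Moore–Penrose pseudoinverse `A†`. -/
def pinv {m k : ℕ} (A : Matrix (Fin m) (Fin k) ℝ) : Matrix (Fin k) (Fin m) ℝ :=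
  if h : ∃ B, IsMoorePenrose A B then h.choose else 0

/-- The projection `H = X (XᵀX)† Xᵀ` onto the column space of `X`. -/
def Hproj {n d : ℕ} (X : Fin n → Fin d → ℝ) : Matrix (Fin n) (Fin n) ℝ :=
  Matrix.of X * pinv ((Matrix.of X)ᵀ * Matrix.of X) * (Matrix.of X)ᵀ

/-! ### Pseudoinverses and projections -/

lemma exists_isMoorePenrose_of_isHermitian {k : ℕ} {A : Matrix (Fin k) (Fin k) ℝ}
    (hA : A.IsHermitian) : ∃ B, IsMoorePenrose A B := by
  obtain ⟨U, D, hU, hU', hAD⟩ : ∃ (U : Matrix (Fin k) (Fin k) ℝ) (D : Fin k → ℝ),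
      Uᵀ * U = 1 ∧ U * Uᵀ = 1 ∧ A = U * diagonal D * Uᵀ := by
    refine ⟨hA.eigenvectorUnitary, hA.eigenvalues, ?_, ?_, ?_⟩
    · have := Matrix.UnitaryGroup.star_mul_self hA.eigenvectorUnitary
      simpa [Matrix.star_eq_conjTranspose, Matrix.conjTranspose_eq_transpose_of_trivial] using this
    · have := Unitary.coe_mul_star_self hA.eigenvectorUnitary
      simpa [Matrix.star_eq_conjTranspose, Matrix.conjTranspose_eq_transpose_of_trivial] using this
    · have := hA.spectral_theorem
      simpa [Matrix.star_eq_conjTranspose, Matrix.conjTranspose_eq_transpose_of_trivial,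
        Function.comp_def, Unitary.conjStarAlgAut_apply] using this
  have key : ∀ E F : Fin k → ℝ, (U * diagonal E * Uᵀ) * (U * diagonal F * Uᵀ) =
      U * diagonal (fun i => E i * F i) * Uᵀ := by
    intro E F
    calc _ = U * diagonal E * (Uᵀ * U) * diagonal F * Uᵀ := by simp only [Matrix.mul_assoc]
      _ = _ := by rw [hU, Matrix.mul_one, Matrix.mul_assoc U, diagonal_mul_diagonal]
  have keyT : ∀ E : Fin k → ℝ, (U * diagonal E * Uᵀ)ᵀ = U * diagonal E * Uᵀ := by
    intro E
    simp [Matrix.transpose_mul, Matrix.mul_assoc]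
  refine ⟨U * diagonal (fun i => (D i)⁻¹) * Uᵀ, ?_⟩
  subst hAD
  refine ⟨?_, ?_, ?_, ?_⟩
  · rw [key, key]
    congr 3; funext i
    exact mul_inv_mul_cancel (D i)
  · rw [key, key]
    congr 3; funext i
    by_cases h : D i = 0 <;> simp [h]
  · rw [key, keyT]
  · rw [key, keyT]

lemma pinv_spec_of_isHermitian {k : ℕ} {A : Matrix (Fin k) (Fin k) ℝ}
    (hA : A.IsHermitian) : IsMoorePenrose A (pinv A) := by
  have h := exists_isMoorePenrose_of_isHermitian hA
  rw [pinv, dif_pos h]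
  exact h.choose_spec

lemma eq_zero_of_transpose_mul_self_mul {n d m : ℕ} {X : Matrix (Fin n) (Fin d) ℝ}
    {M : Matrix (Fin d) (Fin m) ℝ} (h : Xᵀ * X * M = 0) : X * M = 0 := by
  have : (X * M)ᴴ * (X * M) = 0 := by
    rw [Matrix.conjTranspose_eq_transpose_of_trivial, Matrix.transpose_mul, Matrix.mul_assoc,
      ← Matrix.mul_assoc Xᵀ, h, Matrix.mul_zero]
  exact Matrix.conjTranspose_mul_self_eq_zero.1 this

section Projection

variable {n d : ℕ} (X : Fin n → Fin d → ℝ)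

lemma Hproj_transpose_mul_and : (Hproj X)ᵀ * Matrix.of X = Matrix.of X ∧
    (Hproj X)ᵀ * Hproj X = Hproj X := by
  set Y : Matrix (Fin n) (Fin d) ℝ := Matrix.of X with hY
  have hA : (Yᵀ * Y).IsHermitian := by
    simpa [Matrix.conjTranspose_eq_transpose_of_trivial] using
      Matrix.isHermitian_conjTranspose_mul_self Y
  obtain ⟨h1, h2, h3, h4⟩ := pinv_spec_of_isHermitian hA
  set A := Yᵀ * Y with hAdef
  set B := pinv A
  have hAt : Aᵀ = A := by simp [hAdef, Matrix.transpose_mul]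
  have e1 : Y * (Bᵀ * A - 1) = 0 := by
    apply eq_zero_of_transpose_mul_self_mul
    have h := congrArg Matrix.transpose h1
    simp only [Matrix.transpose_mul, hAt] at h
    rw [Matrix.mul_sub, ← hAdef, h, Matrix.mul_one, sub_self]
  have e2 : Y * Bᵀ * A = Y := by
    rw [Matrix.mul_sub, Matrix.mul_one, sub_eq_zero] at e1
    rw [Matrix.mul_assoc, e1]
  have hH : Hproj X = Y * B * Yᵀ := rfl
  have hHt : (Hproj X)ᵀ = Y * Bᵀ * Yᵀ := by
    rw [hH]; simp [Matrix.transpose_mul, Matrix.mul_assoc]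
  constructor
  · rw [hHt, Matrix.mul_assoc, ← hAdef, e2]
  · calc _ = (Y * Bᵀ * A) * B * Yᵀ := by rw [hHt, hH, hAdef]; simp only [Matrix.mul_assoc]
      _ = _ := by rw [e2, hH]

lemma Hproj_transpose : (Hproj X)ᵀ = Hproj X := by
  have h := (Hproj_transpose_mul_and X).2
  rw [← h, Matrix.transpose_mul, Matrix.transpose_transpose]

lemma sqnorm_eq_dotProduct {m : ℕ} (v : Fin m → ℝ) : sqnorm v = v ⬝ᵥ v := by
  simp [sqnorm, dotProduct, sq]

lemma sqnorm_nonneg {m : ℕ} (v : Fin m → ℝ) : 0 ≤ sqnorm v :=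
  Finset.sum_nonneg fun _ _ => sq_nonneg _

lemma sqnorm_Hproj_mulVec (b : Fin n → ℝ) :
    sqnorm (Hproj X *ᵥ b) = (Hproj X *ᵥ b) ⬝ᵥ b := by
  rw [sqnorm_eq_dotProduct, Matrix.dotProduct_mulVec, Matrix.vecMul_mulVec,
    (Hproj_transpose_mul_and X).2, ← Matrix.mulVec_transpose, Hproj_transpose]

lemma sq_dotProduct_le_sqnorm_mul_sqnorm {m : ℕ} (u v : Fin m → ℝ) :
    (u ⬝ᵥ v) ^ 2 ≤ sqnorm u * sqnorm v :=
  Finset.sum_mul_sq_le_sq_mul_sq _ _ _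

lemma sq_dotProduct_mulVec_le_sqnorm_Hproj (b : Fin n → ℝ) (u : Fin d → ℝ) :
    (b ⬝ᵥ (Matrix.of X *ᵥ u)) ^ 2 ≤ sqnorm (Hproj X *ᵥ b) * sqnorm (Matrix.of X *ᵥ u) := by
  have h : b ⬝ᵥ (Matrix.of X *ᵥ u) = (Hproj X *ᵥ b) ⬝ᵥ (Matrix.of X *ᵥ u) := by
    conv_lhs => rw [← (Hproj_transpose_mul_and X).1, ← Matrix.mulVec_mulVec,
      Matrix.dotProduct_mulVec, Matrix.vecMul_transpose]
  rw [h]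
  exact sq_dotProduct_le_sqnorm_mul_sqnorm _ _

/-- If the `ℓ¹` norm is at most `√K` times the `ℓ²` norm on the column space of `X`, then
projecting a sign vector onto the column space leaves a squared norm of at most `K`. -/
lemma sqnorm_Hproj_le_of_forall {K : ℝ} (hK : 0 ≤ K)
    (h : ∀ v, (∑ i, |(Matrix.of X *ᵥ v) i|) ^ 2 ≤ K * sqnorm (Matrix.of X *ᵥ v))
    {b : Fin n → ℝ} (hb : isSign b) : sqnorm (Hproj X *ᵥ b) ≤ K := by
  have hv : Hproj X *ᵥ b =
      Matrix.of X *ᵥ ((pinv ((Matrix.of X)ᵀ * Matrix.of X) * (Matrix.of X)ᵀ) *ᵥ b) := by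
    rw [Hproj, Matrix.mulVec_mulVec, Matrix.mul_assoc]
  have h1 := h ((pinv ((Matrix.of X)ᵀ * Matrix.of X) * (Matrix.of X)ᵀ) *ᵥ b)
  rw [← hv] at h1
  have h2 : sqnorm (Hproj X *ᵥ b) ≤ ∑ i, |(Hproj X *ᵥ b) i| := by
    rw [sqnorm_Hproj_mulVec]
    refine Finset.sum_le_sum fun i _ => (le_abs_self _).trans ?_
    rw [abs_mul]
    rcases hb i with e | e <;> simp [e]
  have h0 := sqnorm_nonneg (Hproj X *ᵥ b)
  rcases h0.eq_or_lt with e | e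
  · rw [← e]; exact hK
  · have h3 : sqnorm (Hproj X *ᵥ b) ^ 2 ≤ K * sqnorm (Hproj X *ᵥ b) :=
      (pow_le_pow_left₀ h0 h2 2).trans h1
    nlinarith

end Projection

/-! ### Chernoff bounds for Gaussian vectors -/

open ProbabilityTheory in
lemma exists_mgf_lt_one {f : ℝ → ℝ} {γ : Measure ℝ} [IsProbabilityMeasure γ]
    (h0 : 0 ∈ interior (integrableExpSet f γ)) (hmean : ∫ x, f x ∂γ < 0) :
    ∃ θ, 0 < θ ∧ θ ∈ integrableExpSet f γ ∧ mgf f γ θ < 1 := by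
  have hd : HasDerivAt (mgf f γ) (∫ x, f x ∂γ) 0 := by
    rw [← deriv_mgf_zero h0]
    exact (hasDerivAt_mgf h0).differentiableAt.hasDerivAt
  have h1 := (hasDerivWithinAt_iff_tendsto_slope' (s := Set.Ioi 0) (by simp)).1 hd.hasDerivWithinAt
  have h2 : ∀ᶠ y in nhdsWithin (0 : ℝ) (Set.Ioi 0), slope (mgf f γ) 0 y < 0 := by
    have := h1.eventually (gt_mem_nhds hmean)
    simpa using this
  have h3 : ∀ᶠ y in nhdsWithin (0 : ℝ) (Set.Ioi 0), y ∈ integrableExpSet f γ :=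
    nhdsWithin_le_nhds (mem_interior_iff_mem_nhds.1 h0)
  obtain ⟨y, hy, hy3, hy0⟩ := (h2.and (h3.and self_mem_nhdsWithin)).exists
  have hy0 : 0 < y := hy0
  refine ⟨y, hy0, hy3, ?_⟩
  rw [slope_def_field, div_lt_iff₀ (by simpa using hy0)] at hy
  simpa using hy

open ProbabilityTheory in
lemma measure_pi_sum_nonneg_le_pow {f : ℝ → ℝ} {γ : Measure ℝ}
    [IsProbabilityMeasure γ] (h0 : 0 ∈ interior (integrableExpSet f γ))
    (hmean : ∫ x, f x ∂γ < 0) :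
    ∃ ρ, 0 ≤ ρ ∧ ρ < 1 ∧ ∀ n : ℕ,
      (Measure.pi fun _ : Fin n => γ).real {g | 0 ≤ ∑ i, f (g i)} ≤ ρ ^ n := by
  obtain ⟨θ, hθ, hi, hlt⟩ := exists_mgf_lt_one h0 hmean
  refine ⟨mgf f γ θ, mgf_nonneg, hlt, fun n => ?_⟩
  have hprod : ∀ g : Fin n → ℝ, exp (θ * ∑ i, f (g i)) = ∏ i, exp (θ * f (g i)) := by
    intro g; rw [Finset.mul_sum, Real.exp_sum]
  have hint : Integrable (fun g : Fin n → ℝ => exp (θ * ∑ i, f (g i)))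
      (Measure.pi fun _ : Fin n => γ) := by
    simp_rw [hprod]
    exact Integrable.fintype_prod (f := fun _ x => exp (θ * f x)) fun _ => hi
  refine (measure_ge_le_exp_mul_mgf 0 hθ.le hint).trans ?_
  simp only [mul_zero, Real.exp_zero, one_mul, mgf]
  simp_rw [hprod]
  rw [integral_fintype_prod_eq_pow (fun x => exp (θ * f x)), Fintype.card_fin]

open ProbabilityTheory in
lemma integrable_gaussianReal_zero_one_iff {g : ℝ → ℝ} :
    Integrable g (gaussianReal 0 1) ↔ Integrable (fun x => exp (-(1 / 2) * x ^ 2) * g x) := by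
  rw [gaussianReal_of_var_ne_zero _ one_ne_zero,
    integrable_withDensity_iff_integrable_smul' (measurable_gaussianPDF _ _)
      (ae_of_all _ fun _ => gaussianPDF_lt_top)]
  have hc : (√(2 * π * 1))⁻¹ ≠ 0 := by positivity
  refine Iff.trans ?_ (integrable_const_mul_iff hc.isUnit fun x => exp (-(1 / 2) * x ^ 2) * g x)
  refine integrable_congr (ae_of_all _ fun x => ?_)
  simp only [toReal_gaussianPDF, gaussianPDFReal, smul_eq_mul, NNReal.coe_one, sub_zero, mul_one]
  rw [show -x ^ 2 / 2 = -(1 / 2) * x ^ 2 by ring]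
  ring

open ProbabilityTheory in
lemma integral_gaussianReal_zero_one (g : ℝ → ℝ) :
    ∫ x, g x ∂(gaussianReal 0 1) = (√(2 * π))⁻¹ * ∫ x, exp (-(1 / 2) * x ^ 2) * g x := by
  rw [integral_gaussianReal_eq_integral_smul one_ne_zero, ← integral_const_mul]
  refine integral_congr_ae (ae_of_all _ fun x => ?_)
  simp only [gaussianPDFReal, smul_eq_mul, NNReal.coe_one, sub_zero, mul_one]
  rw [show -x ^ 2 / 2 = -(1 / 2) * x ^ 2 by ring]
  ring

open ProbabilityTheory in
lemma integral_abs_gaussianReal : ∫ x, |x| ∂(gaussianReal 0 1) = √(2 / π) := by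
  rw [integral_gaussianReal_zero_one]
  have h1 : ∫ x : ℝ, exp (-(1 / 2) * x ^ 2) * |x| = 2 := by
    have := integral_comp_abs (f := fun x => exp (-(1 / 2) * x ^ 2) * x)
    simp only [sq_abs] at this
    rw [this]
    have h2 := integral_rpow_mul_exp_neg_mul_rpow (p := 2) (q := 1) (b := 1 / 2)
      (by norm_num) (by norm_num) (by norm_num)
    have h3 : ∫ x in Set.Ioi (0 : ℝ), exp (-(1 / 2) * x ^ 2) * x =
        ∫ x in Set.Ioi (0 : ℝ), x ^ (1 : ℝ) * exp (-(1 / 2) * x ^ (2 : ℝ)) := by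
      refine integral_congr_ae (ae_of_all _ fun x => ?_)
      simp [mul_comm]
    rw [h3, h2]
    norm_num [Real.Gamma_one]
  rw [h1]
  rw [show (2 : ℝ) / π = 2 ^ 2 / (2 * π) by field_simp, Real.sqrt_div (by positivity),
    Real.sqrt_sq (by norm_num)]
  field_simp

open ProbabilityTheory in
lemma integral_sq_gaussianReal : ∫ x, x ^ 2 ∂(gaussianReal 0 1) = 1 := by
  have := variance_fun_id_gaussianReal (μ := 0) (v := 1)
  rw [variance_of_integral_eq_zero (by fun_prop) (by simp)] at this
  simpa using this

open ProbabilityTheory in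
lemma integrable_exp_mul_sq_gaussianReal {t : ℝ} (ht : t < 1 / 2) :
    Integrable (fun x => exp (t * x ^ 2)) (gaussianReal 0 1) := by
  rw [integrable_gaussianReal_zero_one_iff]
  simp_rw [← Real.exp_add]
  have := integrable_exp_neg_mul_sq (b := 1 / 2 - t) (by linarith)
  refine this.congr (ae_of_all _ fun x => ?_)
  simp only
  congr 1; ring

open ProbabilityTheory in
lemma zero_mem_interior_integrableExpSet_abs (a : ℝ) :
    0 ∈ interior (integrableExpSet (fun x => |x| - a) (gaussianReal 0 1)) := by
  rw [mem_interior_iff_mem_nhds]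
  refine Filter.mem_of_superset univ_mem fun t _ => ?_
  simp only [integrableExpSet, Set.mem_ofPred_eq, mul_sub, Real.exp_sub]
  exact (integrable_exp_mul_abs (X := fun x => x) (integrable_exp_mul_gaussianReal t)
    (integrable_exp_mul_gaussianReal (-t))).div_const _

open ProbabilityTheory in
lemma zero_mem_interior_integrableExpSet_sq (s a : ℝ) :
    0 ∈ interior (integrableExpSet (fun x => s * x ^ 2 - a) (gaussianReal 0 1)) := by
  rw [mem_interior_iff_mem_nhds]
  have : ∀ᶠ t : ℝ in nhds 0, t * s < 1 / 2 := by
    have : Tendsto (fun t : ℝ => t * s) (nhds 0) (nhds (0 * s)) := by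
      exact (continuous_mul_const s).tendsto 0
    exact this.eventually (gt_mem_nhds (by norm_num))
  filter_upwards [this] with t ht
  simp only [integrableExpSet, Set.mem_ofPred_eq, mul_sub, Real.exp_sub]
  simp_rw [← mul_assoc]
  exact (integrable_exp_mul_sq_gaussianReal ht).div_const _

open ProbabilityTheory in
/-- With exponentially high probability a standard Gaussian vector of length `n` has `ℓ¹` norm at
most `a n` and squared `ℓ²` norm between `b n` and `2 n`. -/
lemma exists_gaussian_norm_bounds {a b : ℝ} (ha : √(2 / π) < a) (hb : b < 1) :
    ∃ ρ : ℝ, 0 ≤ ρ ∧ ρ < 1 ∧ ∀ n : ℕ,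
      (Measure.pi fun _ : Fin n => gaussianReal 0 1).real
        {g | ¬ (∑ i, |g i| < a * n ∧ b * n < sqnorm g ∧ sqnorm g < 2 * n)} ≤ 3 * ρ ^ n := by
  have hsq : Integrable (fun x : ℝ => x ^ 2) (gaussianReal 0 1) :=
    (memLp_id_gaussianReal' 2 (by simp)).integrable_sq
  have habs : Integrable (fun x : ℝ => |x|) (gaussianReal 0 1) :=
    ((memLp_id_gaussianReal' 1 (by simp)).integrable le_rfl).abs
  obtain ⟨ρ₁, h10, h11, h1⟩ := measure_pi_sum_nonneg_le_pow
    (zero_mem_interior_integrableExpSet_abs a) (by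
      rw [integral_sub habs (integrable_const _), integral_abs_gaussianReal]; simpa using ha)
  obtain ⟨ρ₂, h20, h21, h2⟩ := measure_pi_sum_nonneg_le_pow
    (zero_mem_interior_integrableExpSet_sq (-1) (-b)) (by
      rw [integral_sub (hsq.const_mul _) (integrable_const _), integral_const_mul,
        integral_sq_gaussianReal]
      simp; linarith)
  obtain ⟨ρ₃, h30, h31, h3⟩ := measure_pi_sum_nonneg_le_pow
    (zero_mem_interior_integrableExpSet_sq 1 2) (by
      rw [integral_sub (hsq.const_mul _) (integrable_const _), integral_const_mul,
        integral_sq_gaussianReal]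
      simp)
  refine ⟨max ρ₁ (max ρ₂ ρ₃), le_max_of_le_left h10, by simp [h11, h21, h31], fun n => ?_⟩
  have hsub : {g : Fin n → ℝ | ¬ (∑ i, |g i| < a * n ∧ b * n < sqnorm g ∧ sqnorm g < 2 * n)} ⊆
      {g | 0 ≤ ∑ i, (|g i| - a)} ∪ ({g | 0 ≤ ∑ i, (-1 * g i ^ 2 - -b)} ∪
        {g | 0 ≤ ∑ i, (1 * g i ^ 2 - 2)}) := by
    intro g hg
    simp only [Set.mem_union, Set.mem_ofPred_eq, Finset.sum_sub_distrib, Finset.sum_const,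
      Finset.card_univ, Fintype.card_fin, nsmul_eq_mul, ← Finset.mul_sum]
    by_contra hcon
    push Not at hcon
    refine hg ⟨by linarith, ?_, ?_⟩ <;> simp only [sqnorm] <;> linarith
  refine (measureReal_mono hsub).trans ((measureReal_union_le _ _).trans ?_)
  have hu := measureReal_union_le (μ := Measure.pi fun _ : Fin n => gaussianReal 0 1)
    {g | 0 ≤ ∑ i, (-1 * g i ^ 2 - -b)} {g | 0 ≤ ∑ i, (1 * g i ^ 2 - 2)}
  have e1 := (h1 n).trans (pow_le_pow_left₀ h10 (le_max_left ρ₁ (max ρ₂ ρ₃)) n)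
  have e2 := (h2 n).trans (pow_le_pow_left₀ h20 ((le_max_left ρ₂ ρ₃).trans (le_max_right ρ₁ _)) n)
  have e3 := (h3 n).trans (pow_le_pow_left₀ h30 ((le_max_right ρ₂ ρ₃).trans (le_max_right ρ₁ _)) n)
  linarith

/-! ### Laws of Gaussian matrices -/

lemma withDensity_pi_prod {ι : Type*} [Fintype ι] {E : ι → Type*} [∀ i, MeasurableSpace (E i)]
    (μ : ∀ i, Measure (E i)) [∀ i, SigmaFinite (μ i)] {f : ∀ i, E i → ℝ}
    (hf : ∀ i, Integrable (f i) (μ i)) (h0 : ∀ i x, 0 ≤ f i x) :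
    (Measure.pi μ).withDensity (fun x => ENNReal.ofReal (∏ i, f i (x i))) =
      Measure.pi fun i => (μ i).withDensity fun x => ENNReal.ofReal (f i x) := by
  have : ∀ i, IsFiniteMeasure ((μ i).withDensity fun x => ENNReal.ofReal (f i x)) :=
    fun i => isFiniteMeasure_withDensity_ofReal (hf i).2
  symm
  refine Measure.pi_eq fun s hs => ?_
  rw [withDensity_apply _ (MeasurableSet.univ_pi hs), Measure.restrict_pi_pi,
    ← ofReal_integral_eq_lintegral_ofReal
      (Integrable.fintype_prod_dep fun i => (hf i).restrict)
      (ae_of_all _ fun x => Finset.prod_nonneg fun i _ => h0 i _),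
    integral_fintype_prod_eq_prod, ENNReal.ofReal_prod_of_nonneg
      (fun i _ => integral_nonneg fun x => h0 i x)]
  refine Finset.prod_congr rfl fun i _ => ?_
  rw [withDensity_apply _ (hs i), ← ofReal_integral_eq_lintegral_ofReal (hf i).restrict
    (ae_of_all _ fun x => h0 i x)]

section GaussianLaws

open scoped NNReal

open ProbabilityTheory in
lemma g1_eq_gaussianPDFReal (m : ℝ) (v : ℝ≥0) (x : ℝ) : g1 m v x = gaussianPDFReal m v x := by
  rw [g1, gaussianPDFReal, show -(1 : ℝ) / 2 = -(1 / 2) by ring,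
    Real.rpow_neg (by positivity), ← Real.sqrt_eq_rpow]

open ProbabilityTheory in
lemma withDensity_prod_g1 (n d : ℕ) (m : Fin n → Fin d → ℝ) {v : Fin d → ℝ≥0}
    (hv : ∀ j, v j ≠ 0) :
    (volume : Measure (Fin n → Fin d → ℝ)).withDensity
        (fun X => ENNReal.ofReal (∏ i, ∏ j, g1 (m i j) (v j) (X i j))) =
      Measure.pi fun i => Measure.pi fun j => gaussianReal (m i j) (v j) := by
  simp only [g1_eq_gaussianPDFReal]
  rw [volume_pi, withDensity_pi_prod (E := fun _ => Fin d → ℝ) (fun _ => volume)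
    (f := fun i x => ∏ j, gaussianPDFReal (m i j) (v j) (x j))]
  · congr! with i
    rw [volume_pi, withDensity_pi_prod]
    · congr 1; funext j
      rw [gaussianReal_of_var_ne_zero _ (hv j), gaussianPDF_def]
    · exact fun j => integrable_gaussianPDFReal _ _
    · exact fun j => gaussianPDFReal_nonneg _ _
  · intro i
    rw [volume_pi]
    exact Integrable.fintype_prod fun j => integrable_gaussianPDFReal _ _
  · exact fun i x => Finset.prod_nonneg fun j _ => gaussianPDFReal_nonneg _ _ _

open ProbabilityTheory in
lemma stdMatLaw_eq_pi (n d : ℕ) :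
    stdMatLaw n d = Measure.pi fun _ => Measure.pi fun _ => gaussianReal 0 1 := by
  have := withDensity_prod_g1 n d (fun _ _ => 0) (v := fun _ => 1) (fun _ => one_ne_zero)
  simpa [stdMatLaw] using this

instance (n d : ℕ) : IsProbabilityMeasure (stdMatLaw n d) := by
  rw [stdMatLaw_eq_pi]; infer_instance

lemma gaussDensity_diagonal {d : ℕ} (m : Fin d → ℝ) {v : Fin d → ℝ≥0} (hv : ∀ j, v j ≠ 0)
    (x : Fin d → ℝ) :
    gaussDensity m (diagonal fun j => (v j : ℝ)) x = ∏ j, g1 (m j) (v j) (x j) := by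
  have hv' : ∀ j, (v j : ℝ) ≠ 0 := fun j => by simpa using hv j
  have hinv : (diagonal fun j => (v j : ℝ))⁻¹ = diagonal fun j => (v j : ℝ)⁻¹ := by
    apply Matrix.inv_eq_left_inv
    rw [diagonal_mul_diagonal, ← diagonal_one]
    congr 1; funext j; exact inv_mul_cancel₀ (hv' j)
  simp only [gaussDensity, g1]
  rw [Finset.prod_mul_distrib, ← Real.exp_sum, hinv, det_diagonal]
  congr 1
  · rw [Real.finsetProd_rpow _ _ fun j _ => by positivity, Finset.prod_mul_distrib,
      Real.mul_rpow (by positivity) (Finset.prod_nonneg fun j _ => by positivity)]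
    congr 1
    rw [Finset.prod_const, Finset.card_univ, Fintype.card_fin, ← Real.rpow_natCast,
      ← Real.rpow_mul (by positivity)]
    congr 1; ring
  · congr 1
    rw [dotProduct, Finset.mul_sum]
    refine Finset.sum_congr rfl fun j _ => ?_
    rw [mulVec_diagonal]
    simp only [Pi.sub_apply]
    field_simp [hv' j]

open ProbabilityTheory in
lemma rowsGaussLaw_diagonal (n d : ℕ) (m : Fin n → Fin d → ℝ) {v : Fin d → ℝ≥0}
    (hv : ∀ j, v j ≠ 0) :
    rowsGaussLaw n d m (diagonal fun j => (v j : ℝ)) =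
      Measure.pi fun i => Measure.pi fun j => gaussianReal (m i j) (v j) := by
  rw [← withDensity_prod_g1 n d m hv, rowsGaussLaw]
  simp only [gaussDensity_diagonal _ hv]

end GaussianLaws

section Rotation

variable {n d : ℕ} {Q : Matrix (Fin d) (Fin d) ℝ}

/-- Right multiplication of all rows by `Q`. -/
def rowsMul (n : ℕ) {d : ℕ} (Q : Matrix (Fin d) (Fin d) ℝ) (X : Fin n → Fin d → ℝ) :
    Fin n → Fin d → ℝ := fun i => X i ᵥ* Q

lemma measurable_rowsMul : Measurable (rowsMul n Q) := by
  unfold rowsMul vecMul dotProduct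
  fun_prop

lemma abs_det_eq_one_of_orthogonal (hQ : Qᵀ * Q = 1) : |Q.det| = 1 := by
  have := congrArg Matrix.det hQ
  rw [det_mul, det_transpose, det_one] at this
  rcases mul_self_eq_one_iff.1 this with h | h <;> simp [h]

lemma measurePreserving_rowsMul (hQ : Qᵀ * Q = 1) :
    MeasurePreserving (rowsMul n Q) := by
  refine volume_preserving_pi (f := fun _ x => x ᵥ* Q) fun i => ⟨?_, ?_⟩
  · unfold vecMul dotProduct
    fun_prop
  · have hdet : Qᵀ.det ≠ 0 := by
      rw [det_transpose, ← abs_ne_zero, abs_det_eq_one_of_orthogonal hQ]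
      exact one_ne_zero
    have h := Real.map_matrix_volume_pi_eq_smul_volume_pi hdet
    rw [det_transpose, abs_inv, abs_det_eq_one_of_orthogonal hQ, inv_one, ENNReal.ofReal_one,
      one_smul] at h
    have e : (fun x : Fin d → ℝ => x ᵥ* Q) = toLin' Qᵀ := by
      funext x
      rw [toLin'_apply, mulVec_transpose]
    change Measure.map (fun x : Fin d → ℝ => x ᵥ* Q) volume = volume
    rw [e]
    exact h

lemma gaussDensity_vecMul (hQ : Qᵀ * Q = 1) (m : Fin d → ℝ) (S : Matrix (Fin d) (Fin d) ℝ)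
    (x : Fin d → ℝ) :
    gaussDensity (m ᵥ* Q) (Qᵀ * S * Q) (x ᵥ* Q) = gaussDensity m S x := by
  have hQ' : Q * Qᵀ = 1 := mul_eq_one_comm.1 hQ
  have hinv : (Qᵀ * S * Q)⁻¹ = Qᵀ * S⁻¹ * Q := by
    rw [Matrix.mul_inv_rev, Matrix.mul_inv_rev, Matrix.inv_eq_left_inv hQ,
      Matrix.inv_eq_left_inv hQ', Matrix.mul_assoc]
  have hdet : (Qᵀ * S * Q).det = S.det := by
    rw [det_mul, det_mul, mul_right_comm, ← det_mul, hQ, det_one, one_mul]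
  have hdot : (x ᵥ* Q - m ᵥ* Q) ⬝ᵥ ((Qᵀ * S⁻¹ * Q) *ᵥ (x ᵥ* Q - m ᵥ* Q)) =
      (x - m) ⬝ᵥ (S⁻¹ *ᵥ (x - m)) := by
    rw [← sub_vecMul, dotProduct_mulVec, vecMul_vecMul,
      show Q * (Qᵀ * S⁻¹ * Q) = S⁻¹ * Q by rw [← Matrix.mul_assoc, ← Matrix.mul_assoc, hQ',
        Matrix.one_mul], ← vecMul_vecMul,
      ← mulVec_transpose Q (x - m), dotProduct_mulVec, vecMul_vecMul, hQ', vecMul_one,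
      ← dotProduct_mulVec]
  rw [gaussDensity, gaussDensity, hinv, hdet, hdot]

lemma measurable_gaussDensity (m : Fin d → ℝ) (S : Matrix (Fin d) (Fin d) ℝ) :
    Measurable (gaussDensity m S) := by
  unfold gaussDensity
  simp only [mulVec, dotProduct, Pi.sub_apply]
  fun_prop

lemma map_rowsMul_rowsGaussLaw (hQ : Qᵀ * Q = 1) (m : Fin n → Fin d → ℝ)
    (S : Matrix (Fin d) (Fin d) ℝ) :
    Measure.map (rowsMul n Q) (rowsGaussLaw n d m S) =
      rowsGaussLaw n d (fun i => m i ᵥ* Q) (Qᵀ * S * Q) := by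
  ext s hs
  rw [Measure.map_apply measurable_rowsMul hs, rowsGaussLaw, rowsGaussLaw,
    withDensity_apply _ hs, withDensity_apply _ (measurable_rowsMul hs),
    ← (measurePreserving_rowsMul hQ).setLIntegral_comp_preimage hs]
  · simp only [rowsMul, gaussDensity_vecMul hQ]
  · refine ENNReal.measurable_ofReal.comp (Finset.measurable_prod _ fun i _ => ?_)
    exact (measurable_gaussDensity _ _).comp (measurable_pi_apply i)

lemma stdMatLaw_eq_rowsGaussLaw : stdMatLaw n d = rowsGaussLaw n d 0 1 := by
  have := rowsGaussLaw_diagonal n d 0 (v := fun _ => 1) (fun _ => one_ne_zero)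
  rw [stdMatLaw_eq_pi]
  simpa using this.symm

lemma map_rowsMul_stdMatLaw (hQ : Qᵀ * Q = 1) :
    Measure.map (rowsMul n Q) (stdMatLaw n d) = stdMatLaw n d := by
  rw [stdMatLaw_eq_rowsGaussLaw, map_rowsMul_rowsGaussLaw hQ]
  congr 1
  · funext i; simp
  · simp [hQ]

end Rotation

lemma map_pi_prod_pi {ι : Type*} [Fintype ι] {α β γ : Type*} [MeasurableSpace α]
    [MeasurableSpace β] [MeasurableSpace γ] (μ : ι → Measure α) (ν : ι → Measure β)
    [∀ i, IsProbabilityMeasure (μ i)] [∀ i, IsProbabilityMeasure (ν i)]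
    {f : ι → α × β → γ} (hf : ∀ i, Measurable (f i)) :
    ((Measure.pi μ).prod (Measure.pi ν)).map (fun p i => f i (p.1 i, p.2 i)) =
      Measure.pi fun i => ((μ i).prod (ν i)).map (f i) := by
  have h := measurePreserving_arrowProdEquivProdArrow α β ι μ ν
  have : ∀ i, IsProbabilityMeasure (((μ i).prod (ν i)).map (f i)) :=
    fun i => Measure.isProbabilityMeasure_map (hf i).aemeasurable
  rw [← h.map_eq, Measure.map_map (by fun_prop) h.measurable,
    ← Measure.pi_map_pi fun i => (hf i).aemeasurable]
  rfl

open ProbabilityTheory in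
lemma map_add_mul_gaussianReal (m a e : ℝ) :
    ((gaussianReal 0 1).prod (gaussianReal 0 1)).map (fun p => m + a * p.1 + e * p.2) =
      gaussianReal m (.mk (a ^ 2) (sq_nonneg a) + .mk (e ^ 2) (sq_nonneg e)) := by
  have h1 : ((gaussianReal 0 1).prod (gaussianReal 0 1)).map (fun p => m + a * p.1) =
      gaussianReal m (.mk (a ^ 2) (sq_nonneg a)) := by
    have : (fun p : ℝ × ℝ => m + a * p.1) = (m + ·) ∘ (a * ·) ∘ Prod.fst := rfl
    rw [this, ← Measure.map_map (by fun_prop) (by fun_prop),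
      ← Measure.map_map (by fun_prop) (by fun_prop), Measure.map_fst_prod]
    simp only [measure_univ, one_smul]
    rw [gaussianReal_map_const_mul, gaussianReal_map_const_add]
    simp
  have h2 : ((gaussianReal 0 1).prod (gaussianReal 0 1)).map (fun p => e * p.2) =
      gaussianReal 0 (.mk (e ^ 2) (sq_nonneg e)) := by
    have : (fun p : ℝ × ℝ => e * p.2) = (e * ·) ∘ Prod.snd := rfl
    rw [this, ← Measure.map_map (by fun_prop) (by fun_prop), Measure.map_snd_prod]
    simp only [measure_univ, one_smul]
    rw [gaussianReal_map_const_mul]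
    simp
  have hind : IndepFun (fun p : ℝ × ℝ => m + a * p.1) (fun p => e * p.2)
      ((gaussianReal 0 1).prod (gaussianReal 0 1)) :=
    indepFun_prod (X := fun x => m + a * x) (Y := fun x => e * x) (by fun_prop) (by fun_prop)
  have := gaussianReal_add_gaussianReal_of_indepFun hind h1 h2
  rw [add_zero] at this
  exact this

/-- The covariance eigenvalues of the noisy planted model. -/
def noisyVar (d : ℕ) (e : ℝ) (k : Fin d) : ℝ := if (k : ℕ) = 0 then e ^ 2 else 1 + e ^ 2

lemma noisyVar_pos {d : ℕ} {e : ℝ} (he : e ≠ 0) (k : Fin d) : 0 < noisyVar d e k := by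
  unfold noisyVar; split_ifs <;> positivity

/-- The planted matrix in the original coordinates: first column replaced by `y`. -/
def plant {n d : ℕ} (y : Fin n → ℝ) (G : Fin n → Fin d → ℝ) : Fin n → Fin d → ℝ :=
  fun i k => if (k : ℕ) = 0 then y i else G i k

lemma measurable_plant {n d : ℕ} :
    Measurable fun p : (Fin n → ℝ) × (Fin n → Fin d → ℝ) => plant p.1 p.2 := by
  refine measurable_pi_lambda _ fun i => measurable_pi_lambda _ fun k => ?_
  unfold plant
  split_ifs <;> fun_prop

/-- The first coordinate vector. -/
def firstVec (d : ℕ) : Fin d → ℝ := fun k => if (k : ℕ) = 0 then 1 else 0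

open ProbabilityTheory in
lemma map_plant_add_noise (n d : ℕ) {e : ℝ} (he : e ≠ 0) (y : Fin n → ℝ) :
    ((stdMatLaw n d).prod (stdMatLaw n d)).map (fun p => plant y p.1 + e • p.2) =
      rowsGaussLaw n d (fun i => y i • firstVec d) (diagonal (noisyVar d e)) := by
  have hv : ∀ k, NNReal.mk (noisyVar d e k) (noisyVar_pos he k).le ≠ 0 := fun k h =>
    (noisyVar_pos he k).ne' (congrArg NNReal.toReal h)
  have hR := rowsGaussLaw_diagonal n d (fun i => y i • firstVec d) hv
  refine Eq.trans ?_ hR.symm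
  rw [stdMatLaw_eq_pi]
  have hf : ∀ i, ∀ k : Fin d, Measurable fun q : ℝ × ℝ =>
      (y i * firstVec d k + (1 - firstVec d k) * q.1 + e * q.2) := by
    intro i k; fun_prop
  have hF : (fun p : (Fin n → Fin d → ℝ) × (Fin n → Fin d → ℝ) => plant y p.1 + e • p.2) =
      fun p i => (fun q : (Fin d → ℝ) × (Fin d → ℝ) => fun k =>
        (fun r : ℝ × ℝ => y i * firstVec d k + (1 - firstVec d k) * r.1 + e * r.2)
          (q.1 k, q.2 k)) (p.1 i, p.2 i) := by
    funext p i k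
    simp only [plant, firstVec, Pi.add_apply, Pi.smul_apply, smul_eq_mul]
    split_ifs <;> ring
  rw [hF]
  refine (map_pi_prod_pi (fun _ => Measure.pi fun _ => gaussianReal 0 1)
    (fun _ => Measure.pi fun _ => gaussianReal 0 1)
    (f := fun i (q : (Fin d → ℝ) × (Fin d → ℝ)) => fun k =>
        (fun r : ℝ × ℝ => y i * firstVec d k + (1 - firstVec d k) * r.1 + e * r.2)
          (q.1 k, q.2 k)) fun i => by fun_prop).trans ?_
  congr 1; funext i
  refine (map_pi_prod_pi (fun _ => gaussianReal 0 1) (fun _ => gaussianReal 0 1)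
    (f := fun k (r : ℝ × ℝ) =>
      y i * firstVec d k + (1 - firstVec d k) * r.1 + e * r.2) (hf i)).trans ?_
  congr 1; funext k
  rw [map_add_mul_gaussianReal]
  congr 1
  ext
  simp only [NNReal.coe_add, NNReal.coe_mk, noisyVar, firstVec]
  split_ifs <;> simp

lemma map_rotated_plant_add_noise {n d : ℕ} {Q : Matrix (Fin d) (Fin d) ℝ} (hQ : Qᵀ * Q = 1)
    {e : ℝ} (he : e ≠ 0) (y : Fin n → ℝ) :
    ((stdMatLaw n d).prod (stdMatLaw n d)).map (fun p => rowsMul n Q (plant y p.1) + e • p.2) =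
      rowsGaussLaw n d (fun i => y i • (firstVec d ᵥ* Q))
        (Qᵀ * diagonal (noisyVar d e) * Q) := by
  have h0 : Measurable fun p : (Fin n → Fin d → ℝ) × (Fin n → Fin d → ℝ) => plant y p.1 :=
    measurable_plant.comp (measurable_const.prodMk measurable_fst)
  have hm : Measurable fun p : (Fin n → Fin d → ℝ) × (Fin n → Fin d → ℝ) =>
      plant y p.1 + e • p.2 := h0.add (by fun_prop)
  have hQs : (stdMatLaw n d).prod (stdMatLaw n d) =
      ((stdMatLaw n d).prod (stdMatLaw n d)).map (Prod.map id (rowsMul n Q)) := by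
    conv_lhs => rw [← map_rowsMul_stdMatLaw hQ (n := n)]
    conv_lhs => arg 1; rw [map_rowsMul_stdMatLaw hQ (n := n), ← Measure.map_id (μ := stdMatLaw n d)]
    rw [Measure.map_prod_map _ _ measurable_id measurable_rowsMul]
  have hm2 : Measurable fun p : (Fin n → Fin d → ℝ) × (Fin n → Fin d → ℝ) =>
      rowsMul n Q (plant y p.1) + e • p.2 :=
    (measurable_rowsMul.comp h0).add (by fun_prop)
  have hvec : (fun i => y i • (firstVec d ᵥ* Q)) = fun i => (y i • firstVec d) ᵥ* Q := by
    funext i; rw [smul_vecMul]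
  rw [hvec, ← map_rowsMul_rowsGaussLaw hQ (fun i => y i • firstVec d), ← map_plant_add_noise n d he y,
    Measure.map_map measurable_rowsMul hm, hQs,
    Measure.map_map hm2 (measurable_id.prodMap measurable_rowsMul), ← hQs]
  congr 1
  funext p
  simp only [Function.comp, Prod.map, id]
  funext i
  simp only [rowsMul, Pi.add_apply, Pi.smul_apply, add_vecMul, smul_vecMul]

/-! ### The `ℓ¹` and `ℓ²` norms on a random subspace -/

/-- Euclidean norm of a tuple. -/
def nrm {m : ℕ} (v : Fin m → ℝ) : ℝ := ‖WithLp.toLp 2 v‖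

lemma nrm_sq {m : ℕ} (v : Fin m → ℝ) : nrm v ^ 2 = sqnorm v := by
  simp [nrm, sqnorm, EuclideanSpace.norm_sq_eq]

lemma nrm_nonneg {m : ℕ} (v : Fin m → ℝ) : 0 ≤ nrm v := norm_nonneg _

lemma nrm_add_le {m : ℕ} (u v : Fin m → ℝ) : nrm (u + v) ≤ nrm u + nrm v := by
  simpa [nrm] using norm_add_le (WithLp.toLp 2 u) (WithLp.toLp 2 v)

lemma nrm_smul {m : ℕ} (r : ℝ) (v : Fin m → ℝ) : nrm (r • v) = |r| * nrm v := by
  simp [nrm, norm_smul]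

lemma nrm_sum_le {m : ℕ} {ι : Type*} (s : Finset ι) (f : ι → Fin m → ℝ) :
    nrm (∑ j ∈ s, f j) ≤ ∑ j ∈ s, nrm (f j) := by
  simpa [nrm] using norm_sum_le s fun j => WithLp.toLp 2 (f j)

lemma nrm_eq_zero {m : ℕ} {v : Fin m → ℝ} : nrm v = 0 ↔ v = 0 := by
  simp [nrm]

lemma sum_abs_le_sqrt_mul_nrm {m : ℕ} (v : Fin m → ℝ) : ∑ i, |v i| ≤ √m * nrm v := by
  have h := Finset.sum_mul_sq_le_sq_mul_sq Finset.univ (fun _ : Fin m => (1 : ℝ)) fun i => |v i|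
  simp only [one_mul, one_pow, Finset.sum_const, Finset.card_univ, Fintype.card_fin,
    nsmul_eq_mul, mul_one, sq_abs] at h
  rw [← sqnorm, ← nrm_sq] at h
  refine abs_le_of_sq_le_sq' ?_ (by positivity [nrm_nonneg v]) |>.2
  rw [mul_pow, Real.sq_sqrt (by positivity)]
  exact h

lemma abs_apply_le_nrm {m : ℕ} (v : Fin m → ℝ) (i : Fin m) : |v i| ≤ nrm v := by
  refine abs_le_of_sq_le_sq ?_ (nrm_nonneg v)
  rw [nrm_sq]
  exact Finset.single_le_sum (f := fun i => v i ^ 2) (fun _ _ => sq_nonneg _) (Finset.mem_univ i)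

open ProbabilityTheory in
lemma map_dotProduct_pi_gaussianReal {d : ℕ} {w : Fin d → ℝ} (hw : sqnorm w = 1) :
    (Measure.pi fun _ : Fin d => gaussianReal 0 1).map (fun x => x ⬝ᵥ w) = gaussianReal 0 1 := by
  set L : StrongDual ℝ (EuclideanSpace ℝ (Fin d)) := innerSL ℝ (WithLp.toLp 2 w) with hL
  have h1 : (fun x : Fin d → ℝ => x ⬝ᵥ w) = L ∘ WithLp.toLp 2 := by
    funext x
    simp [hL, EuclideanSpace.inner_eq_star_dotProduct]
  rw [h1, ← Measure.map_map (by fun_prop) (by fun_prop), map_pi_eq_stdGaussian,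
    IsGaussian.map_eq_gaussianReal, integral_strongDual_stdGaussian, variance_dual_stdGaussian]
  have h2 : ‖L‖ ^ 2 = 1 := by
    rw [hL, innerSL_apply_norm, ← hw, ← nrm_sq, nrm]
  rw [h2]
  simp

open ProbabilityTheory in
lemma map_mulVec_stdMatLaw {n d : ℕ} {w : Fin d → ℝ} (hw : sqnorm w = 1) :
    (stdMatLaw n d).map (fun X => Matrix.of X *ᵥ w) = Measure.pi fun _ => gaussianReal 0 1 := by
  have hm : Measurable fun x : Fin d → ℝ => x ⬝ᵥ w := by unfold dotProduct; fun_prop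
  have : ∀ _ : Fin n, IsProbabilityMeasure
      ((Measure.pi fun _ : Fin d => gaussianReal 0 1).map fun x => x ⬝ᵥ w) :=
    fun _ => Measure.isProbabilityMeasure_map hm.aemeasurable
  have h := Measure.pi_map_pi (μ := fun _ : Fin n => Measure.pi fun _ : Fin d => gaussianReal 0 1)
    (f := fun _ x => x ⬝ᵥ w) fun _ => hm.aemeasurable
  rw [map_dotProduct_pi_gaussianReal hw] at h
  rw [stdMatLaw_eq_pi, ← h]
  rfl

/-- The image of `k` under `X` has the `ℓ¹` and `ℓ²` norms expected of a Gaussian vector. -/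
def IsTame {n d : ℕ} (X : Fin n → Fin d → ℝ) (k : Fin d → ℝ) : Prop :=
  ∑ i, |(Matrix.of X *ᵥ k) i| ≤ 0.8 * n * nrm k ∧
    0.98 * √n * nrm k ≤ nrm (Matrix.of X *ᵥ k) ∧ nrm (Matrix.of X *ᵥ k) ≤ 1.5 * √n * nrm k

lemma sqrt_two_div_pi_lt : √(2 / π) < 0.8 := by
  rw [Real.sqrt_lt' (by norm_num), div_lt_iff₀ Real.pi_pos]
  nlinarith [Real.pi_gt_d2]

lemma exists_measure_not_isTame_le : ∃ ρ : ℝ, 0 ≤ ρ ∧ ρ < 1 ∧ ∀ (n d : ℕ) (k : Fin d → ℝ), k ≠ 0 →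
    (stdMatLaw n d).real {X | ¬ IsTame X k} ≤ 3 * ρ ^ n := by
  obtain ⟨ρ, h0, h1, h⟩ := exists_gaussian_norm_bounds sqrt_two_div_pi_lt
    (show (0.98 ^ 2 : ℝ) < 1 by norm_num)
  refine ⟨ρ, h0, h1, fun n d k hk => ?_⟩
  have hk0 : 0 < nrm k := (nrm_nonneg k).lt_of_ne' (by rwa [Ne, nrm_eq_zero])
  set w : Fin d → ℝ := (nrm k)⁻¹ • k with hwdef
  have hkw : k = nrm k • w := by rw [hwdef, smul_smul, mul_inv_cancel₀ hk0.ne', one_smul]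
  have hw : sqnorm w = 1 := by
    rw [← nrm_sq, hwdef, nrm_smul, abs_inv, abs_of_pos hk0, inv_mul_cancel₀ hk0.ne', one_pow]
  refine le_trans ?_ (h n)
  have hm : Measurable fun X : Fin n → Fin d → ℝ => Matrix.of X *ᵥ w := by
    unfold mulVec dotProduct
    simp only [Matrix.of_apply]
    fun_prop
  rw [← map_mulVec_stdMatLaw hw (n := n), measureReal_def, measureReal_def]
  refine ENNReal.toReal_mono ?_ (le_trans (measure_mono ?_) (Measure.le_map_apply hm.aemeasurable _))
  · have := Measure.isProbabilityMeasure_map (μ := stdMatLaw n d) hm.aemeasurable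
    exact measure_ne_top _ _
  · intro X hX hg
    refine hX ?_
    obtain ⟨g1, g2, g3⟩ := hg
    set u := Matrix.of X *ᵥ w with hu
    have hXk : Matrix.of X *ᵥ k = nrm k • u := by rw [hu, ← mulVec_smul, ← hkw]
    rw [← nrm_sq] at g2 g3
    have hn := Real.sq_sqrt (Nat.cast_nonneg (α := ℝ) n)
    refine ⟨?_, ?_, ?_⟩ <;> rw [hXk]
    · simp only [Pi.smul_apply, smul_eq_mul, abs_mul, ← Finset.mul_sum, abs_of_pos hk0]
      rw [mul_comm]
      gcongr
    · rw [nrm_smul, abs_of_pos hk0, mul_comm]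
      gcongr
      refine abs_le_of_sq_le_sq' ?_ (nrm_nonneg u) |>.2
      rw [mul_pow, hn]
      exact g2.le
    · rw [nrm_smul, abs_of_pos hk0, mul_comm]
      gcongr
      refine abs_le_of_sq_le_sq' ?_ (by positivity) |>.2
      rw [mul_pow, hn]
      nlinarith [Nat.cast_nonneg (α := ℝ) n]

/-- The nonzero lattice points of the cube `[-N, N]^d`. -/
def gridPoints (d N : ℕ) : Finset (Fin d → ℤ) :=
  (Fintype.piFinset fun _ => Finset.Icc (-(N : ℤ)) N).erase 0

lemma card_gridPoints_le (d N : ℕ) : (gridPoints d N).card ≤ (2 * N + 1) ^ d := by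
  refine (Finset.card_erase_le).trans ?_
  rw [Fintype.card_piFinset_const, Int.card_Icc]
  refine Nat.pow_le_pow_left ?_ d
  lia

/-- If `X` is tame on all lattice points of a fine grid then the `ℓ¹` norm is at most
`√((2/π + 0.1) n)` times the `ℓ²` norm on the whole column space. -/
lemma sq_sum_abs_mulVec_le {n d : ℕ} (hn : 1 ≤ n) (hd : 200 * d ≤ n) {X : Fin n → Fin d → ℝ}
    (hX : ∀ k ∈ gridPoints d n, IsTame X fun j => (k j : ℝ)) (v : Fin d → ℝ) :
    (∑ i, |(Matrix.of X *ᵥ v) i|) ^ 2 ≤ (2 / π + 0.1) * n * sqnorm (Matrix.of X *ᵥ v) := by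
  rcases eq_or_ne v 0 with rfl | hv
  · simp [sqnorm]
  have hv0 : 0 < nrm v := (nrm_nonneg v).lt_of_ne' (by rwa [Ne, nrm_eq_zero])
  have hn1 : (1 : ℝ) ≤ n := by exact_mod_cast hn
  have hdn : (200 : ℝ) * d ≤ n := by exact_mod_cast hd
  have hn0 : (0 : ℝ) < n := by linarith
  set s : ℝ := nrm v / n with hs
  have hs0 : 0 < s := by positivity
  set u : Fin d → ℝ := s⁻¹ • v with hu
  have hvu : v = s • u := by rw [hu, smul_smul, mul_inv_cancel₀ hs0.ne', one_smul]
  have hun : nrm u = n := by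
    rw [hu, nrm_smul, abs_inv, abs_of_pos hs0, hs]; field_simp
  set k : Fin d → ℤ := fun j => ⌊u j⌋ with hk
  set kr : Fin d → ℝ := fun j => (k j : ℝ) with hkr
  set r : Fin d → ℝ := fun j => Int.fract (u j) with hr
  have hukr : u = kr + r := by
    funext j; simp [hkr, hk, hr, Int.floor_add_fract]
  have hunit : ∀ j, nrm (Pi.single j (1 : ℝ) : Fin d → ℝ) = 1 := fun j => by simp [nrm]
  have hrsum : r = ∑ j, r j • (Pi.single j (1 : ℝ) : Fin d → ℝ) := by
    funext i; simp [Finset.sum_apply, Pi.single_apply]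
  have hr1 : ∀ j, |r j| ≤ 1 := fun j => by
    rw [hr, abs_of_nonneg (Int.fract_nonneg _)]; exact (Int.fract_lt_one _).le
  have hrn : nrm r ≤ d := by
    rw [hrsum]
    refine (nrm_sum_le _ _).trans ?_
    calc _ ≤ ∑ j : Fin d, (1 : ℝ) := by
          refine Finset.sum_le_sum fun j _ => ?_
          rw [nrm_smul, hunit, mul_one]; exact hr1 j
      _ = d := by simp
  have hkn : 0.995 * n ≤ nrm kr := by
    have := nrm_add_le kr r
    rw [← hukr, hun] at this
    linarith
  have hkgrid : k ∈ gridPoints d n := by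
    rw [gridPoints, Finset.mem_erase]
    constructor
    · intro h
      have : kr = 0 := by funext j; simp [hkr, h]
      rw [nrm_eq_zero.2 this] at hkn
      linarith
    · rw [Fintype.mem_piFinset]
      intro j
      have h := abs_le.1 (abs_apply_le_nrm u j)
      rw [hun] at h
      rw [Finset.mem_Icc]
      constructor
      · rw [hk, Int.le_floor]; push_cast; exact h.1
      · have := Int.floor_le (u j)
        have h2 : ((⌊u j⌋ : ℤ) : ℝ) ≤ ((n : ℤ) : ℝ) := by push_cast; linarith [h.2]
        exact_mod_cast h2
  have hebound : ∀ j, nrm (Matrix.of X *ᵥ (Pi.single j (1 : ℝ) : Fin d → ℝ)) ≤ 1.5 * √n := by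
    intro j
    have hmem : (Pi.single j 1 : Fin d → ℤ) ∈ gridPoints d n := by
      rw [gridPoints, Finset.mem_erase, Fintype.mem_piFinset]
      refine ⟨by simp, fun i => ?_⟩
      rw [Finset.mem_Icc, Pi.single_apply]
      split_ifs <;> lia
    have h := (hX _ hmem).2.2
    have e : (fun i => (((Pi.single j 1 : Fin d → ℤ) i : ℤ) : ℝ)) =
        (Pi.single j (1 : ℝ) : Fin d → ℝ) := by
      funext i; simp only [Pi.single_apply]; split_ifs <;> simp
    rw [e, hunit, mul_one] at h
    exact h
  have hE : nrm (Matrix.of X *ᵥ r) ≤ d * (1.5 * √n) := by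
    rw [hrsum, mulVec_sum]
    refine (nrm_sum_le _ _).trans ?_
    calc _ ≤ ∑ j : Fin d, (1.5 * √n) := by
          refine Finset.sum_le_sum fun j _ => ?_
          rw [mulVec_smul, nrm_smul]
          calc _ ≤ 1 * (1.5 * √n) := by
                gcongr
                · exact nrm_nonneg _
                · exact hr1 j
                · exact hebound j
            _ = _ := one_mul _
      _ = _ := by simp
  obtain ⟨t1, t2, -⟩ := hX k hkgrid
  set A := nrm (Matrix.of X *ᵥ kr) with hA
  set B := nrm (Matrix.of X *ᵥ u) with hB
  set E := nrm (Matrix.of X *ᵥ r) with hEdef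
  have hXu : Matrix.of X *ᵥ u = Matrix.of X *ᵥ kr + Matrix.of X *ᵥ r := by
    rw [← mulVec_add, ← hukr]
  have hAB : A ≤ B + E := by
    have h := nrm_add_le (Matrix.of X *ᵥ u) (-1 • (Matrix.of X *ᵥ r))
    have e : Matrix.of X *ᵥ u + -1 • (Matrix.of X *ᵥ r) = Matrix.of X *ᵥ kr := by
      rw [hXu]; simp
    have e2 : nrm (-1 • (Matrix.of X *ᵥ r)) = E := by
      have := nrm_smul (-1) (Matrix.of X *ᵥ r)
      simpa using this
    rw [e, e2] at h
    exact h
  have hsn : 0 ≤ √(n : ℝ) := Real.sqrt_nonneg _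
  have hsq : √(n : ℝ) * √n = n := Real.mul_self_sqrt hn0.le
  have hE' : E ≤ 0.0075 * (√n * n) := by nlinarith
  have hA' : 0.97 * (√n * n) ≤ A := by nlinarith
  have hEB : E ≤ 0.015 * B := by nlinarith [mul_nonneg hsn hn0.le]
  have hB0 : 0 ≤ B := nrm_nonneg _
  have hL : ∑ i, |(Matrix.of X *ᵥ u) i| ≤ √n * (0.85 * B) := by
    calc _ ≤ ∑ i, |(Matrix.of X *ᵥ kr) i| + ∑ i, |(Matrix.of X *ᵥ r) i| := by
          rw [hXu, ← Finset.sum_add_distrib]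
          exact Finset.sum_le_sum fun i _ => abs_add_le _ _
      _ ≤ 0.8 * n * nrm kr + √n * E := add_le_add t1 (sum_abs_le_sqrt_mul_nrm _)
      _ = √n * (0.8 * (√n * nrm kr) + E) := by
          linear_combination (-(0.8 : ℝ) * nrm kr) * hsq
      _ ≤ √n * (0.85 * B) := by
          gcongr
          nlinarith
  have hLu : (∑ i, |(Matrix.of X *ᵥ u) i|) ^ 2 ≤ (2 / π + 0.1) * n * sqnorm (Matrix.of X *ᵥ u) := by
    rw [← nrm_sq, ← hB]
    have hπ : (0.7225 : ℝ) ≤ 2 / π + 0.1 := by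
      have : (0.6225 : ℝ) ≤ 2 / π := by
        rw [le_div_iff₀ Real.pi_pos]
        nlinarith [Real.pi_lt_d2]
      linarith
    calc _ ≤ (√n * (0.85 * B)) ^ 2 :=
          pow_le_pow_left₀ (Finset.sum_nonneg fun _ _ => abs_nonneg _) hL 2
      _ = 0.7225 * n * B ^ 2 := by rw [mul_pow, Real.sq_sqrt hn0.le]; ring
      _ ≤ _ := by gcongr
  have hXv : Matrix.of X *ᵥ v = s • (Matrix.of X *ᵥ u) := by rw [hvu, mulVec_smul]
  rw [hXv]
  simp only [sqnorm, Pi.smul_apply, smul_eq_mul, abs_mul, mul_pow, ← Finset.mul_sum]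
  rw [sq_abs, mul_left_comm]
  exact mul_le_mul_of_nonneg_left hLu (sq_nonneg s)

/-- With overwhelming probability, no sign vector has a large projection onto the column space of
a Gaussian matrix. -/
lemma exists_measure_large_projection_le : ∃ ρ : ℝ, 0 ≤ ρ ∧ ρ < 1 ∧ ∀ n d : ℕ, 1 ≤ n →
    200 * d ≤ n → (stdMatLaw n d).real
      {X | ∃ b, isSign b ∧ (2 / π + 0.1) * n < sqnorm (Hproj X *ᵥ b)} ≤
        (2 * n + 1) ^ d * (3 * ρ ^ n) := by
  obtain ⟨ρ, h0, h1, h⟩ := exists_measure_not_isTame_le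
  refine ⟨ρ, h0, h1, fun n d hn hd => ?_⟩
  calc _ ≤ (stdMatLaw n d).real
        (⋃ k ∈ gridPoints d n, {X | ¬ IsTame X fun j => (k j : ℝ)}) := by
        refine measureReal_mono ?_ (measure_ne_top _ _)
        rintro X ⟨b, hb, hlt⟩
        by_contra hcon
        simp only [Set.mem_iUnion, Set.mem_ofPred_eq, not_exists, not_not] at hcon
        exact hlt.not_ge (sqnorm_Hproj_le_of_forall X (by positivity)
          (sq_sum_abs_mulVec_le hn hd hcon) hb)
    _ ≤ ∑ k ∈ gridPoints d n, (stdMatLaw n d).real {X | ¬ IsTame X fun j => (k j : ℝ)} :=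
        measureReal_biUnion_finset_le _ _
    _ ≤ ∑ _k ∈ gridPoints d n, 3 * ρ ^ n := by
        refine Finset.sum_le_sum fun k hk => h n d _ fun hz => ?_
        refine (Finset.mem_erase.1 hk).1 ?_
        funext j
        simpa using congrFun hz j
    _ = (gridPoints d n).card * (3 * ρ ^ n) := by simp
    _ ≤ _ := by
        gcongr
        exact_mod_cast card_gridPoints_le d n

/-! ### The error of type II -/

lemma natCard_ne_eq_sum {n : ℕ} (a b : Fin n → ℝ) :
    (Nat.card {i : Fin n // a i ≠ b i} : ℝ) = ∑ i, ({x | x ≠ 0} : Set ℝ).indicator 1 (a i - b i) := by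
  classical
  rw [Nat.card_eq_fintype_card, Fintype.card_subtype]
  simp only [Set.indicator_apply, Set.mem_ofPred_eq, Ne, sub_eq_zero, Pi.one_apply]
  rw [Finset.sum_boole]

lemma measurable_natCard_ne {n : ℕ} :
    Measurable fun p : (Fin n → ℝ) × (Fin n → ℝ) => (Nat.card {i : Fin n // p.1 i ≠ p.2 i} : ℝ) := by
  simp only [natCard_ne_eq_sum]
  refine Finset.measurable_sum _ fun i _ => ?_
  exact ((measurable_one.indicator (measurableSet_singleton 0).compl)).comp
    (f := fun p : (Fin n → ℝ) × (Fin n → ℝ) => p.1 i - p.2 i) (by fun_prop)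

lemma measurable_misclass {α : Type*} [MeasurableSpace α] {n : ℕ} {f g : α → Fin n → ℝ}
    (hf : Measurable f) (hg : Measurable g) : Measurable fun x => misclass n (f x) (g x) := by
  have h : Measurable fun p : (Fin n → ℝ) × (Fin n → ℝ) =>
      (Nat.card {i : Fin n // -(p.1 i) ≠ p.2 i} : ℝ) :=
    measurable_natCard_ne.comp (f := fun p : (Fin n → ℝ) × (Fin n → ℝ) => (-p.1, p.2)) (by fun_prop)
  have h0 : Measurable fun p : (Fin n → ℝ) × (Fin n → ℝ) => misclass n p.1 p.2 :=
    (measurable_natCard_ne.min h).const_mul _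
  have h1 := h0.comp (hf.prodMk hg)
  exact h1

lemma misclass_nonneg (n : ℕ) (a b : Fin n → ℝ) : 0 ≤ misclass n a b := by
  unfold misclass; positivity

lemma misclass_le_one (n : ℕ) (a b : Fin n → ℝ) : misclass n a b ≤ 1 := by
  rcases Nat.eq_zero_or_pos n with rfl | hn
  · simp [misclass]
  have hn' : (0 : ℝ) < n := by exact_mod_cast hn
  rw [misclass, inv_mul_le_iff₀ hn', mul_one]
  refine (min_le_left _ _).trans ?_
  have := Nat.card_le_card_of_injective (α := {i : Fin n // a i ≠ b i}) (β := Fin n) Subtype.val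
    Subtype.val_injective
  rw [Nat.card_fin] at this
  exact_mod_cast this

lemma dotProduct_eq_of_isSign {n : ℕ} {a b : Fin n → ℝ} (ha : isSign a) (hb : isSign b) :
    a ⬝ᵥ b = n - 2 * Nat.card {i : Fin n // a i ≠ b i} := by
  have : (n : ℝ) = ∑ _i : Fin n, (1 : ℝ) := by simp
  rw [natCard_ne_eq_sum, this, Finset.mul_sum, ← Finset.sum_sub_distrib, dotProduct]
  refine Finset.sum_congr rfl fun i _ => ?_
  rcases ha i with h | h <;> rcases hb i with h' | h' <;> simp [h, h'] <;> norm_num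

lemma sq_dotProduct_eq_of_isSign {n : ℕ} {a b : Fin n → ℝ} (ha : isSign a) (hb : isSign b) :
    (a ⬝ᵥ b) ^ 2 = (n - 2 * (n * misclass n a b)) ^ 2 := by
  rcases Nat.eq_zero_or_pos n with rfl | hn
  · simp [dotProduct]
  have hn' : (n : ℝ) ≠ 0 := by positivity
  have ha' : isSign fun i => -a i := fun i => by
    rcases ha i with h | h <;> simp [h]
  have h1 := dotProduct_eq_of_isSign ha hb
  have h2 := dotProduct_eq_of_isSign ha' hb
  have h3 : (fun i => -a i) ⬝ᵥ b = -(a ⬝ᵥ b) := neg_dotProduct a b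
  rw [misclass, mul_inv_cancel_left₀ hn']
  rcases min_choice (Nat.card {i : Fin n // a i ≠ b i} : ℝ) (Nat.card {i : Fin n // -(a i) ≠ b i} : ℝ)
    with h | h <;> rw [h]
  · rw [h1]
  · rw [← h2, h3, neg_sq]

lemma le_misclass_of_sq_dotProduct_le {n : ℕ} (hn : 1 ≤ n) {a b : Fin n → ℝ} (ha : isSign a)
    (hb : isSign b) (h : (a ⬝ᵥ b) ^ 2 ≤ (2 / π + 0.1) * n * n) : 0.07 ≤ misclass n a b := by
  by_contra! hlt
  have hn' : (0 : ℝ) < n := by exact_mod_cast hn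
  rw [sq_dotProduct_eq_of_isSign ha hb] at h
  have hπ : 2 / π < 0.637 := by
    rw [div_lt_iff₀ Real.pi_pos]
    nlinarith [Real.pi_gt_d4]
  have h1 : (0.86 * n) ^ 2 ≤ (n - 2 * (n * misclass n a b)) ^ 2 := by
    apply pow_le_pow_left₀ (by positivity)
    nlinarith
  nlinarith [mul_pos hn' hn']

lemma isSign_signVec {n : ℕ} (s : Fin n → Bool) : isSign (signVec s) := by
  intro i
  unfold signVec
  split_ifs <;> simp

lemma sqnorm_eq_of_isSign {n : ℕ} {y : Fin n → ℝ} (hy : isSign y) : sqnorm y = n := by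
  have : ∀ i, y i ^ 2 = 1 := fun i => by rcases hy i with h | h <;> simp [h]
  simp [sqnorm, this]

instance (n : ℕ) : IsProbabilityMeasure (uniformSigns n) := by
  constructor
  simp [uniformSigns, ENNReal.inv_mul_cancel]

lemma ae_isSign_uniformSigns (n : ℕ) : ∀ᵐ y ∂uniformSigns n, isSign y := by
  refine Measure.ae_smul_measure ?_ _
  rw [ae_iff, Measure.finsetSum_apply]
  refine Finset.sum_eq_zero fun s _ => ?_
  rw [← ae_iff]
  have hm : MeasurableSet {y : Fin n → ℝ | isSign y} := by
    unfold isSign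
    measurability
  rw [ae_dirac_iff hm]
  exact isSign_signVec s

lemma plantedLaw_eq_map (n d : ℕ) (Q : Matrix (Fin d) (Fin d) ℝ) :
    plantedLaw n d Q = ((uniformSigns n).prod (stdMatLaw n d)).map
      fun p => rowsMul n Q (plant p.1 p.2) := rfl

lemma measurable_sqnorm {m : ℕ} : Measurable (sqnorm (m := m)) := by
  unfold sqnorm
  fun_prop

section Rotation

variable {n d : ℕ} {Q : Matrix (Fin d) (Fin d) ℝ}

lemma measurable_rowsMul_plant :
    Measurable fun p : (Fin n → ℝ) × (Fin n → Fin d → ℝ) => rowsMul n Q (plant p.1 p.2) :=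
  measurable_rowsMul.comp measurable_plant

lemma isProbabilityMeasure_plantedLaw : IsProbabilityMeasure (plantedLaw n d Q) := by
  rw [plantedLaw_eq_map]
  exact Measure.isProbabilityMeasure_map measurable_rowsMul_plant.aemeasurable

lemma posDef_rotated_noise (hQ : Qᵀ * Q = 1) {e : ℝ} (he : e ≠ 0) :
    (Qᵀ * diagonal (noisyVar d e) * Q).PosDef := by
  have h : (diagonal (noisyVar d e)).PosDef := posDef_diagonal_iff.2 fun k => noisyVar_pos he k
  have := h.conjTranspose_mul_mul_same (B := Q) (Function.LeftInverse.injective (g := Qᵀ.mulVec)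
    fun x => by rw [mulVec_mulVec, hQ, one_mulVec])
  simpa using this

lemma rotated_noise_snr (hQ : Qᵀ * Q = 1) (hd : 1 ≤ d) {e : ℝ} (he : e ≠ 0) :
    (firstVec d ᵥ* Q) ⬝ᵥ ((Qᵀ * diagonal (noisyVar d e) * Q)⁻¹ *ᵥ (firstVec d ᵥ* Q)) =
      1 / e ^ 2 := by
  have hQ' : Q * Qᵀ = 1 := mul_eq_one_comm.1 hQ
  have hD : (diagonal (noisyVar d e))⁻¹ = diagonal fun k => (noisyVar d e k)⁻¹ := by
    apply Matrix.inv_eq_left_inv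
    rw [diagonal_mul_diagonal, ← diagonal_one]
    congr 1; funext j; exact inv_mul_cancel₀ (noisyVar_pos he j).ne'
  have hinv : (Qᵀ * diagonal (noisyVar d e) * Q)⁻¹ =
      Qᵀ * (diagonal fun k => (noisyVar d e k)⁻¹) * Q := by
    rw [Matrix.mul_inv_rev, Matrix.mul_inv_rev, Matrix.inv_eq_left_inv hQ,
      Matrix.inv_eq_left_inv hQ', hD, Matrix.mul_assoc]
  have hv : Q *ᵥ (firstVec d ᵥ* Q) = firstVec d := by
    rw [← mulVec_transpose, mulVec_mulVec, hQ', one_mulVec]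
  rw [hinv, ← mulVec_mulVec, hv, ← mulVec_mulVec, dotProduct_mulVec, vecMul_transpose, hv, dotProduct]
  obtain ⟨m, rfl⟩ : ∃ m, d = m + 1 := ⟨d - 1, by lia⟩
  rw [Finset.sum_eq_single 0]
  · rw [mulVec_diagonal]
    simp [firstVec, noisyVar]
  · intro k _ hk
    have : (k : ℕ) ≠ 0 := fun h => hk (Fin.ext h)
    rw [firstVec, if_neg this, zero_mul]
  · simp

lemma map_planted_add_noise (hQ : Qᵀ * Q = 1) {e : ℝ} (he : e ≠ 0) :
    (((uniformSigns n).prod (stdMatLaw n d)).prod (stdMatLaw n d)).map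
        (fun p => (p.1.1, rowsMul n Q (plant p.1.1 p.1.2) + e • p.2)) =
      mixtureJoint n d (firstVec d ᵥ* Q) (Qᵀ * diagonal (noisyVar d e) * Q) := by
  set F : ((Fin n → ℝ) × (Fin n → Fin d → ℝ)) × (Fin n → Fin d → ℝ) →
      (Fin n → ℝ) × (Fin n → Fin d → ℝ) :=
    fun p => (p.1.1, rowsMul n Q (plant p.1.1 p.1.2) + e • p.2) with hF
  have hFm : Measurable F :=
    measurable_fst.fst.prodMk ((measurable_rowsMul_plant.comp measurable_fst).add (by fun_prop))
  have hrow : ∀ y : Fin n → ℝ, Measurable fun p : (Fin n → Fin d → ℝ) × (Fin n → Fin d → ℝ) =>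
      rowsMul n Q (plant y p.1) + e • p.2 := fun y =>
    (measurable_rowsMul_plant.comp (measurable_const.prodMk measurable_fst)).add (by fun_prop)
  ext s hs
  have hind : Measurable fun x => s.indicator 1 (F x) :=
    (measurable_one (α := ℝ≥0∞) |>.indicator hs).comp hFm
  rw [← lintegral_indicator_one hs, lintegral_map (measurable_one.indicator hs) hFm,
    lintegral_prod _ hind.aemeasurable, lintegral_prod _ hind.lintegral_prod_right'.aemeasurable,
    uniformSigns, lintegral_smul_measure, lintegral_finsetSum_measure, mixtureJoint,
    Measure.smul_apply, Measure.finsetSum_apply]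
  congr 1
  refine Finset.sum_congr rfl fun t _ => ?_
  rw [lintegral_dirac' _ hind.lintegral_prod_right'.lintegral_prod_right',
    ← map_rotated_plant_add_noise hQ he, Measure.dirac_prod,
    Measure.map_apply measurable_prodMk_left hs,
    Measure.map_apply (hrow _) (measurable_prodMk_left hs),
    ← lintegral_indicator_one ((hrow _) (measurable_prodMk_left hs)), lintegral_prod]
  · rfl
  · exact (measurable_one.indicator ((hrow _) (measurable_prodMk_left hs))).aemeasurable

lemma mulVec_rowsMul_plant (hQ : Qᵀ * Q = 1) (hd : 1 ≤ d) (y : Fin n → ℝ)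
    (G : Fin n → Fin d → ℝ) :
    Matrix.of (rowsMul n Q (plant y G)) *ᵥ (firstVec d ᵥ* Q) = y := by
  have hQ' : Q * Qᵀ = 1 := mul_eq_one_comm.1 hQ
  funext i
  change (plant y G i ᵥ* Q) ⬝ᵥ (firstVec d ᵥ* Q) = y i
  rw [← mulVec_transpose Q (firstVec d), dotProduct_mulVec, vecMul_vecMul, hQ', vecMul_one, dotProduct]
  obtain ⟨m, rfl⟩ : ∃ m, d = m + 1 := ⟨d - 1, by lia⟩
  rw [Finset.sum_eq_single 0]
  · simp [firstVec, plant]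
  · intro k _ hk
    have : (k : ℕ) ≠ 0 := fun h => hk (Fin.ext h)
    rw [firstVec, if_neg this, mul_zero]
  · simp

lemma measure_planted_small_projection_le {Ω : Type*} [MeasureSpace Ω]
    [IsProbabilityMeasure (volume : Measure Ω)] (hn : 1 ≤ n) (hd : 1 ≤ d) (hQ : Qᵀ * Q = 1) {e : ℝ}
    (he : e ≠ 0) {φ : (Fin n → Fin d → ℝ) × Ω → Fin n → ℝ} (hφm : Measurable φ)
    (hφs : ∀ q, isSign (φ q)) :
    ((plantedLaw n d Q).prod ((stdMatLaw n d).prod (volume : Measure Ω))).real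
        {q | ¬(2 / π + 0.1 <
          sqnorm (Hproj q.1 *ᵥ φ (fun i j => q.1 i j + e * q.2.1 i j, q.2.2)) / n)} ≤
      0.07⁻¹ * ∫ q, misclass n (φ (q.1.2, q.2)) q.1.1
        ∂((mixtureJoint n d (firstVec d ᵥ* Q) (Qᵀ * diagonal (noisyVar d e) * Q)).prod
          (volume : Measure Ω)) := by
  have hn' : (0 : ℝ) < n := by exact_mod_cast hn
  have := isProbabilityMeasure_plantedLaw (n := n) (Q := Q)
  set u := firstVec d ᵥ* Q with hu
  have hFm : Measurable fun p : ((Fin n → ℝ) × (Fin n → Fin d → ℝ)) × (Fin n → Fin d → ℝ) =>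
      (p.1.1, rowsMul n Q (plant p.1.1 p.1.2) + e • p.2) :=
    measurable_fst.fst.prodMk ((measurable_rowsMul_plant.comp measurable_fst).add (by fun_prop))
  set W := (((uniformSigns n).prod (stdMatLaw n d)).prod (stdMatLaw n d)).prod (volume : Measure Ω)
    with hW
  have hmix : W.map (Prod.map (fun p => (p.1.1, rowsMul n Q (plant p.1.1 p.1.2) + e • p.2)) id) =
      (mixtureJoint n d u (Qᵀ * diagonal (noisyVar d e) * Q)).prod volume := by
    rw [hW, ← Measure.map_prod_map _ _ hFm measurable_id, map_planted_add_noise hQ he,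
      Measure.map_id]
  have hΨm := hFm.prodMap (measurable_id (α := Ω))
  have := Measure.isProbabilityMeasure_map (μ := W) hΨm.aemeasurable
  rw [hmix] at this
  have hpl : W.map (fun p => (rowsMul n Q (plant p.1.1.1 p.1.1.2), (p.1.2, p.2))) =
      (plantedLaw n d Q).prod ((stdMatLaw n d).prod volume) := by
    rw [plantedLaw_eq_map, ← Measure.map_id (μ := (stdMatLaw n d).prod (volume : Measure Ω)),
      Measure.map_prod_map _ _ measurable_rowsMul_plant measurable_id, ← Measure.prodAssoc_prod,
      Measure.map_map (measurable_rowsMul_plant.prodMap measurable_id)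
        MeasurableEquiv.prodAssoc.measurable]
    rfl
  have hplm : Measurable fun p : (((Fin n → ℝ) × (Fin n → Fin d → ℝ)) × (Fin n → Fin d → ℝ)) × Ω =>
      (rowsMul n Q (plant p.1.1.1 p.1.1.2), (p.1.2, p.2)) :=
    (measurable_rowsMul_plant.comp measurable_fst.fst).prodMk (by fun_prop)
  have hsign : ∀ᵐ p ∂W, isSign p.1.1.1 :=
    Measure.quasiMeasurePreserving_fst.ae (Measure.quasiMeasurePreserving_fst.ae
      (Measure.quasiMeasurePreserving_fst.ae (ae_isSign_uniformSigns n)))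
  have hφn : Measurable fun q : (Fin n → Fin d → ℝ) × (Fin n → Fin d → ℝ) × Ω =>
      φ (fun i j => q.1 i j + e * q.2.1 i j, q.2.2) := hφm.comp (by fun_prop)
  have hXu : Measurable fun q : (Fin n → Fin d → ℝ) × (Fin n → Fin d → ℝ) × Ω =>
      Matrix.of q.1 *ᵥ u := by
    unfold mulVec dotProduct
    simp only [Matrix.of_apply]
    fun_prop
  set T : Set ((Fin n → Fin d → ℝ) × (Fin n → Fin d → ℝ) × Ω) :=
    {q | (φ (fun i j => q.1 i j + e * q.2.1 i j, q.2.2) ⬝ᵥ (Matrix.of q.1 *ᵥ u)) ^ 2 ≤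
      (2 / π + 0.1) * n * sqnorm (Matrix.of q.1 *ᵥ u)} with hT
  have hTm : MeasurableSet T := by
    refine measurableSet_le (Measurable.pow_const ?_ 2) ((measurable_sqnorm.comp hXu).const_mul _)
    unfold dotProduct
    fun_prop
  have hφ' : Measurable fun q : ((Fin n → ℝ) × (Fin n → Fin d → ℝ)) × Ω => φ (q.1.2, q.2) :=
    hφm.comp (measurable_fst.snd.prodMk measurable_snd)
  have hmis := measurable_misclass hφ' measurable_fst.fst
  have hint : Integrable (fun q : ((Fin n → ℝ) × (Fin n → Fin d → ℝ)) × Ω =>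
      misclass n (φ (q.1.2, q.2)) q.1.1)
      ((mixtureJoint n d u (Qᵀ * diagonal (noisyVar d e) * Q)).prod volume) := by
    refine Integrable.of_bound hmis.aestronglyMeasurable 1 (ae_of_all _ fun q => ?_)
    rw [Real.norm_of_nonneg (misclass_nonneg _ _ _)]
    exact misclass_le_one _ _ _
  have hmarkov := mul_meas_ge_le_integral_of_nonneg
    (ae_of_all _ fun q : ((Fin n → ℝ) × (Fin n → Fin d → ℝ)) × Ω =>
      misclass_nonneg n (φ (q.1.2, q.2)) q.1.1) hint 0.07
  rw [inv_mul_eq_div, le_div_iff₀' (by norm_num)]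
  refine le_trans (mul_le_mul_of_nonneg_left ?_ (by norm_num)) hmarkov
  rw [← hmix, ← hpl, measureReal_def, measureReal_def]
  refine ENNReal.toReal_mono (measure_ne_top _ _) ?_
  calc _ ≤ W.map (fun p => (rowsMul n Q (plant p.1.1.1 p.1.1.2), (p.1.2, p.2))) T := by
        refine measure_mono fun q hq => ?_
        rw [Set.mem_ofPred_eq, not_lt, div_le_iff₀ hn'] at hq
        exact (sq_dotProduct_mulVec_le_sqnorm_Hproj _ _ _).trans
          (mul_le_mul_of_nonneg_right hq (sqnorm_nonneg _))
    _ ≤ _ := by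
        rw [Measure.map_apply hplm hTm, Measure.map_apply hΨm (measurableSet_le measurable_const hmis)]
        refine measure_mono_ae ?_
        filter_upwards [hsign] with p hp hpT
        change (_ ⬝ᵥ (Matrix.of (rowsMul n Q (plant p.1.1.1 p.1.1.2)) *ᵥ u)) ^ 2 ≤
          _ * sqnorm (Matrix.of (rowsMul n Q (plant p.1.1.1 p.1.1.2)) *ᵥ u) at hpT
        rw [mulVec_rowsMul_plant hQ hd, sqnorm_eq_of_isSign hp] at hpT
        exact le_misclass_of_sq_dotProduct_le hn (hφs _) hp hpT

end Rotation

/-! ### Asymptotics -/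

lemma measure_std_large_projection_le {n d : ℕ} (hn : 1 ≤ n) {Ω : Type*} [MeasureSpace Ω]
    [IsProbabilityMeasure (volume : Measure Ω)]
    {ψ : (Fin n → Fin d → ℝ) × (Fin n → Fin d → ℝ) × Ω → Fin n → ℝ} (hψ : ∀ q, isSign (ψ q)) :
    ((stdMatLaw n d).prod ((stdMatLaw n d).prod (volume : Measure Ω))).real
        {q | 2 / π + 0.1 < sqnorm (Hproj q.1 *ᵥ ψ q) / n} ≤
      (stdMatLaw n d).real {X | ∃ b, isSign b ∧ (2 / π + 0.1) * n < sqnorm (Hproj X *ᵥ b)} := by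
  have hn' : (0 : ℝ) < n := by exact_mod_cast hn
  rw [measureReal_def, measureReal_def]
  refine ENNReal.toReal_mono (measure_ne_top _ _) ?_
  calc _ ≤ ((stdMatLaw n d).prod ((stdMatLaw n d).prod (volume : Measure Ω)))
        ({X | ∃ b, isSign b ∧ (2 / π + 0.1) * n < sqnorm (Hproj X *ᵥ b)} ×ˢ Set.univ) := by
        refine measure_mono fun q hq => ⟨⟨ψ q, hψ q, ?_⟩, trivial⟩
        rwa [Set.mem_ofPred_eq, lt_div_iff₀ hn'] at hq
    _ = _ := by rw [Measure.prod_prod, measure_univ, mul_one]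

lemma eventually_mul_le_of_tendsto {d : ℕ → ℕ} (C : ℕ)
    (hdo : Tendsto (fun n : ℕ => (d n : ℝ) * Real.log n / n) atTop (nhds 0)) :
    ∀ᶠ n in atTop, C * d n ≤ n := by
  have hlog2 := Real.log_pos one_lt_two
  filter_upwards [(hdo.const_mul (C : ℝ)).eventually_le_const (u := Real.log 2) (by simpa using hlog2),
    eventually_ge_atTop 2] with n hn hn2
  have hn0 : (0 : ℝ) < n := by positivity
  have hl : Real.log 2 ≤ Real.log n := Real.log_le_log two_pos (by exact_mod_cast hn2)
  rw [mul_div_assoc', div_le_iff₀ hn0] at hn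
  have h : Real.log 2 * ((C : ℝ) * d n) ≤ Real.log 2 * n := by
    refine le_trans ?_ hn
    calc _ = (C : ℝ) * (d n * Real.log 2) := by ring
      _ ≤ _ := by gcongr
  exact_mod_cast le_of_mul_le_mul_left h hlog2

lemma eventually_union_bound_le {d : ℕ → ℕ} (hd : ∀ n, 1 ≤ d n)
    (hdo : Tendsto (fun n : ℕ => (d n : ℝ) * Real.log n / n) atTop (nhds 0)) {c ρ : ℝ} (hc : 0 < c)
    (h0 : 0 ≤ ρ) (h1 : ρ < 1) :
    ∀ᶠ n : ℕ in atTop, (2 * n + 1 : ℝ) ^ d n * (3 * ρ ^ n) ≤ (n : ℝ) ^ (-c) := by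
  wlog hρ : 0 < ρ generalizing ρ
  · filter_upwards [this (ρ := 1 / 2) (by norm_num) (by norm_num) (by norm_num)] with n hn
    refine le_trans ?_ hn
    have : ρ ≤ 1 / 2 := by linarith
    gcongr
  have hL : 0 < -Real.log ρ := neg_pos.2 (Real.log_neg hρ h1)
  filter_upwards [(hdo.const_mul (5 + c)).eventually_le_const (u := -Real.log ρ) (by simpa using hL),
    eventually_ge_atTop 2] with n hn hn2
  have hn2' : (2 : ℝ) ≤ n := by exact_mod_cast hn2
  have hn0 : (0 : ℝ) < n := by linarith
  rw [mul_div_assoc', div_le_iff₀ hn0] at hn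
  have hl : 0 ≤ Real.log n := Real.log_nonneg (by linarith)
  have hd1 : (1 : ℝ) ≤ d n := by exact_mod_cast hd n
  have hld : Real.log n ≤ d n * Real.log n := le_mul_of_one_le_left hl hd1
  have e1 : (2 * n + 1 : ℝ) ^ d n ≤ Real.exp (3 * (d n * Real.log n)) := by
    have : (2 * n + 1 : ℝ) ≤ (n : ℝ) ^ 3 := by nlinarith [mul_nonneg hn0.le hn0.le]
    calc (2 * n + 1 : ℝ) ^ d n ≤ ((n : ℝ) ^ 3) ^ d n := by gcongr
      _ = Real.exp (3 * (d n * Real.log n)) := by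
        nth_rewrite 1 [← Real.exp_log hn0]
        rw [← Real.exp_nat_mul, ← Real.exp_nat_mul]
        congr 1; push_cast; ring
  have e2 : (3 : ℝ) ≤ Real.exp (2 * Real.log n) := by
    rw [mul_comm, Real.exp_mul, Real.exp_log hn0, Real.rpow_two]
    nlinarith
  have e3 : ρ ^ n = Real.exp (n * Real.log ρ) := by
    rw [Real.exp_nat_mul, Real.exp_log hρ]
  calc (2 * n + 1 : ℝ) ^ d n * (3 * ρ ^ n)
      ≤ Real.exp (3 * (d n * Real.log n)) *
          (Real.exp (2 * Real.log n) * Real.exp (n * Real.log ρ)) := by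
        rw [e3]; gcongr
    _ = Real.exp (3 * (d n * Real.log n) + (2 * Real.log n + n * Real.log ρ)) := by
        rw [Real.exp_add, Real.exp_add]
    _ ≤ Real.exp (Real.log n * -c) := by
        gcongr
        nlinarith
    _ = _ := by rw [Real.rpow_def_of_pos hn0]

lemma exists_tendsto_zero_forall_le_rpow {ι : ℕ → Type*} {f : ∀ n, ι n → ℝ} {c C : ℝ} {η : ℕ → ℝ}
    (hC : 0 < C) (hf : ∀ n i, f n i ≤ 2) (hη : Tendsto η atTop (nhds 0))
    (h : ∀ᶠ n : ℕ in atTop, ∀ i, f n i ≤ C * (n : ℝ) ^ (-c + η n)) :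
    ∃ δ : ℕ → ℝ, Tendsto δ atTop (nhds 0) ∧
      ∀ n : ℕ, 2 ≤ n → ∀ i, f n i ≤ (n : ℝ) ^ (-c + δ n) := by
  classical
  refine ⟨fun n => if ∀ i, f n i ≤ C * (n : ℝ) ^ (-c + η n) then η n + Real.log C / Real.log n
    else c + 1, ?_, fun n hn i => ?_⟩
  · have hlog : Tendsto (fun n : ℕ => Real.log C / Real.log n) atTop (nhds 0) :=
      (Real.tendsto_log_atTop.comp tendsto_natCast_atTop_atTop).const_div_atTop _
    refine Tendsto.congr' ?_ (by simpa using hη.add hlog)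
    filter_upwards [h] with n hn
    rw [if_pos hn]
  · have hn2 : (2 : ℝ) ≤ n := by exact_mod_cast hn
    have hn0 : (0 : ℝ) < n := by linarith
    have hl : 0 < Real.log n := Real.log_pos (by linarith)
    dsimp only
    split_ifs with hgood
    · refine (hgood i).trans_eq ?_
      rw [← add_assoc, Real.rpow_add hn0 _ (Real.log C / _), mul_comm C,
        Real.rpow_def_of_pos hn0 (Real.log C / _),
        mul_div_cancel₀ _ hl.ne', Real.exp_log hC]
    · rw [neg_add_cancel_left, Real.rpow_one]
      exact (hf n i).trans hn2

/-- from optimal clustering to testing the planted Boolean vector problem.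
An estimator `φ` (randomized through `Ω'`) achieving error `exp(-SNR/(2+ε_n))` at
`SNR = 2c log n` for every instance yields, through the test
`ψ_ε(X) = H₁ ⟺ ‖H φ(X + εZ)‖₂²/n > 2/π + 0.1` with `ε = 1/√(2c log n)`, a test whose
type I plus type II errors are at most `n^{-c+δ_n}`, uniformly over the orthonormal
matrix `Q` of the `H₁` distribution. -/
theorem clustering_to_testing (c : ℝ) (hc : 0 < c)
    (d : ℕ → ℕ) (hd : ∀ n, 1 ≤ d n)
    (hdo : Tendsto (fun n : ℕ => (d n : ℝ) * Real.log n / n) atTop (nhds 0))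
    (Ω' : ℕ → Type) [∀ n, MeasureSpace (Ω' n)]
    [∀ n, IsProbabilityMeasure (volume : Measure (Ω' n))]
    (φ : (n : ℕ) → (Fin n → Fin (d n) → ℝ) × Ω' n → (Fin n → ℝ))
    (hφm : ∀ n, Measurable (φ n)) (hφs : ∀ n q, isSign (φ n q))
    (ε : ℕ → ℝ) (hε : Tendsto ε atTop (nhds 0))
    (hrisk : ∀ n : ℕ, ∀ (μ : Fin (d n) → ℝ) (S : Matrix (Fin (d n)) (Fin (d n)) ℝ),
      S.PosDef → μ ⬝ᵥ (S⁻¹ *ᵥ μ) = 2 * c * Real.log n →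
      (∫ q, misclass n (φ n (q.1.2, q.2)) q.1.1
          ∂((mixtureJoint n (d n) μ S).prod (volume : Measure (Ω' n)))) ≤
        Real.exp (-(2 * c * Real.log n) / (2 + ε n))) :
    ∃ δ : ℕ → ℝ, Tendsto δ atTop (nhds 0) ∧
      ∀ n : ℕ, 2 ≤ n → ∀ Q : Matrix (Fin (d n)) (Fin (d n)) ℝ, Qᵀ * Q = 1 →
        (((stdMatLaw n (d n)).prod ((stdMatLaw n (d n)).prod (volume : Measure (Ω' n))))
            {q | 2 / π + 0.1 <
              sqnorm (Hproj q.1 *ᵥ φ n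
                (fun i j => q.1 i j + 1 / Real.sqrt (2 * c * Real.log n) * q.2.1 i j,
                  q.2.2)) / n}).toReal +
          (((plantedLaw n (d n) Q).prod ((stdMatLaw n (d n)).prod (volume : Measure (Ω' n))))
            {q | ¬(2 / π + 0.1 <
              sqnorm (Hproj q.1 *ᵥ φ n
                (fun i j => q.1 i j + 1 / Real.sqrt (2 * c * Real.log n) * q.2.1 i j,
                  q.2.2)) / n)}).toReal ≤
          (n : ℝ) ^ (-c + δ n) := by
  obtain ⟨ρ, hρ0, hρ1, hρ⟩ := exists_measure_large_projection_le
  have hden : Tendsto (fun n => 2 + ε n) atTop (nhds 2) := by simpa using hε.const_add 2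
  have hη : Tendsto (fun n => |c - 2 * c / (2 + ε n)|) atTop (nhds 0) := by
    have h := ((tendsto_const_nhds (x := 2 * c).div hden two_ne_zero).const_sub c).abs
    simpa using h
  suffices hmain : ∀ᶠ n : ℕ in atTop, ∀ Q : {Q : Matrix (Fin (d n)) (Fin (d n)) ℝ // Qᵀ * Q = 1}, _ by
    obtain ⟨δ, hδ, h⟩ := exists_tendsto_zero_forall_le_rpow (C := 16) (c := c)
      (ι := fun n => {Q : Matrix (Fin (d n)) (Fin (d n)) ℝ // Qᵀ * Q = 1})
      (f := fun n Q =>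
        ((stdMatLaw n (d n)).prod ((stdMatLaw n (d n)).prod (volume : Measure (Ω' n)))).real
            {q | 2 / π + 0.1 <
              sqnorm (Hproj q.1 *ᵥ φ n
                (fun i j => q.1 i j + 1 / Real.sqrt (2 * c * Real.log n) * q.2.1 i j,
                  q.2.2)) / n} +
          ((plantedLaw n (d n) Q).prod ((stdMatLaw n (d n)).prod (volume : Measure (Ω' n)))).real
            {q | ¬(2 / π + 0.1 <
              sqnorm (Hproj q.1 *ᵥ φ n
                (fun i j => q.1 i j + 1 / Real.sqrt (2 * c * Real.log n) * q.2.1 i j,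
                  q.2.2)) / n)})
      (by norm_num)
      (fun n Q => by
        have := isProbabilityMeasure_plantedLaw (n := n) (Q := Q.1)
        exact (add_le_add measureReal_le_one measureReal_le_one).trans_eq (by norm_num))
      hη hmain
    exact ⟨δ, hδ, fun n hn Q hQ => h n hn ⟨Q, hQ⟩⟩
  filter_upwards [eventually_union_bound_le hd hdo hc hρ0 hρ1, eventually_mul_le_of_tendsto 200 hdo,
    hden.eventually_const_lt (u := 1) (by norm_num), eventually_ge_atTop 2]
    with n hunion h200 hpos hn Q
  obtain ⟨Q, hQ⟩ := Q
  have hn1 : (1 : ℝ) < n := by exact_mod_cast (show 1 < n by lia)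
  have hn0 : (0 : ℝ) < n := by linarith
  have hl : 0 < Real.log n := Real.log_pos hn1
  have hsnr : 0 < 2 * c * Real.log n := by positivity
  have he : 1 / √(2 * c * Real.log n) ≠ 0 := (one_div_pos.2 (Real.sqrt_pos.2 hsnr)).ne'
  have hI := (measure_std_large_projection_le (n := n) (d := d n) (Ω := Ω' n) (by lia)
    (ψ := fun q => φ n (fun i j => q.1 i j + 1 / √(2 * c * Real.log n) * q.2.1 i j, q.2.2))
    fun q => hφs n _).trans ((hρ n (d n) (by lia) h200).trans hunion)
  have hII := (measure_planted_small_projection_le (n := n) (by lia) (hd n) hQ he (hφm n)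
    (hφs n)).trans (mul_le_mul_of_nonneg_left (hrisk n _ _ (posDef_rotated_noise hQ he) (by
      rw [rotated_noise_snr hQ (hd n) he, div_pow, Real.sq_sqrt hsnr.le, one_pow, one_div_one_div]))
      (by norm_num))
  have hexp : Real.exp (-(2 * c * Real.log n) / (2 + ε n)) = (n : ℝ) ^ (-(2 * c / (2 + ε n))) := by
    rw [Real.rpow_def_of_pos hn0]
    congr 1; ring
  rw [hexp] at hII
  have hle1 : (n : ℝ) ^ (-c) ≤ (n : ℝ) ^ (-c + |c - 2 * c / (2 + ε n)|) :=
    Real.rpow_le_rpow_of_exponent_le hn1.le (by linarith [abs_nonneg (c - 2 * c / (2 + ε n))])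
  have hle2 : (n : ℝ) ^ (-(2 * c / (2 + ε n))) ≤ (n : ℝ) ^ (-c + |c - 2 * c / (2 + ε n)|) :=
    Real.rpow_le_rpow_of_exponent_le hn1.le (by linarith [le_abs_self (c - 2 * c / (2 + ε n))])
  have hpow : 0 ≤ (n : ℝ) ^ (-(2 * c / (2 + ε n))) := by positivity
  calc _ ≤ (n : ℝ) ^ (-c) + 0.07⁻¹ * (n : ℝ) ^ (-(2 * c / (2 + ε n))) := add_le_add hI hII
    _ ≤ _ := by
      norm_num at hpow ⊢
      linarith
end
end

section
/- Let X = (x_1, …, x_n)^T ∈ ℝ^{n×d} have rank d and set H = X(X^T X)^{−1} X^T. Define G(β) = ∑_{i=1}^n (|β^T x_i| − 1)² for β ∈ ℝ^d. If β̂ minimizes G over ℝ^d, then both sgn(X β̂) and −sgn(X β̂) (sign taken entrywise with sgn(0) := 1) maximize y ↦ y^T H y over {±1}^n. Conversely, if ŷ maximizes y ↦ y^T H y over {±1}^n, then both (X^T X)^{−1} X^T ŷ and −(X^T X)^{−1} X^T ŷ minimize G over ℝ^d. -/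
open Real Matrix

noncomputable section

/-- The matrix `H = X (XᵀX)⁻¹ Xᵀ`. -/
def Hmat {n d : ℕ} (X : Fin n → Fin d → ℝ) : Matrix (Fin n) (Fin n) ℝ :=
  Matrix.of X * ((Matrix.of X)ᵀ * Matrix.of X)⁻¹ * (Matrix.of X)ᵀ

/-- sign function with the convention `sgn 0 = 1`. -/
def sgn1 (x : ℝ) : ℝ := if 0 ≤ x then 1 else -1

/-- The projection pursuit objective `G(β) = ∑ᵢ (|βᵀxᵢ| - 1)²`. -/
def ppObj {n d : ℕ} (X : Fin n → Fin d → ℝ) (β : Fin d → ℝ) : ℝ :=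
  ∑ i, (|X i ⬝ᵥ β| - 1) ^ 2

/-- A square matrix of full rank over a field is invertible. -/
theorem isUnit_of_rank_eq_card {m K : Type*} [Fintype m] [DecidableEq m] [Field K]
    {A : Matrix m m K} (h : A.rank = Fintype.card m) : IsUnit A := by
  rw [← Matrix.mulVec_surjective_iff_isUnit]
  have htop : LinearMap.range A.mulVecLin = ⊤ :=
    Submodule.eq_top_of_finrank_eq (by rw [Module.finrank_fintype_fun_eq_card]; exact h)
  exact LinearMap.range_eq_top.mp htop

/-- The least-squares coefficients `(XᵀX)⁻¹ Xᵀ y`. -/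
def leastSquares {n d : ℕ} (X : Fin n → Fin d → ℝ) (y : Fin n → ℝ) : Fin d → ℝ :=
  ((Matrix.of X)ᵀ * Matrix.of X)⁻¹ *ᵥ ((Matrix.of X)ᵀ *ᵥ y)

theorem mulVec_leastSquares {n d : ℕ} (X : Fin n → Fin d → ℝ) (y : Fin n → ℝ) :
    Matrix.of X *ᵥ leastSquares X y = Hmat X *ᵥ y := by
  simp only [leastSquares, Hmat, Matrix.mulVec_mulVec, Matrix.mul_assoc]

/-- The normal equations `XᵀHy = Xᵀy`. -/
theorem transpose_mulVec_Hmat_mulVec {n d : ℕ} {X : Fin n → Fin d → ℝ}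
    (hrank : (Matrix.of X).rank = d) (y : Fin n → ℝ) :
    (Matrix.of X)ᵀ *ᵥ (Hmat X *ᵥ y) = (Matrix.of X)ᵀ *ᵥ y := by
  have hu : IsUnit ((Matrix.of X)ᵀ * Matrix.of X) :=
    isUnit_of_rank_eq_card (by rw [Matrix.rank_transpose_mul_self, hrank, Fintype.card_fin])
  rw [← mulVec_leastSquares, leastSquares, Matrix.mulVec_mulVec, Matrix.mulVec_mulVec,
    Matrix.mul_nonsing_inv _ ((Matrix.isUnit_iff_isUnit_det _).mp hu), Matrix.one_mulVec]

theorem mulVec_dotProduct_Hmat_mulVec {n d : ℕ} {X : Fin n → Fin d → ℝ}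
    (hrank : (Matrix.of X).rank = d) (β : Fin d → ℝ) (y : Fin n → ℝ) :
    (Matrix.of X *ᵥ β) ⬝ᵥ (Hmat X *ᵥ y) = (Matrix.of X *ᵥ β) ⬝ᵥ y := by
  have h (w : Fin n → ℝ) : (Matrix.of X *ᵥ β) ⬝ᵥ w = β ⬝ᵥ ((Matrix.of X)ᵀ *ᵥ w) := by
    rw [Matrix.dotProduct_mulVec, Matrix.vecMul_transpose]
  rw [h, h, transpose_mulVec_Hmat_mulVec hrank]

/-- Pythagorean decomposition of the least-squares residual of a sign vector. -/
theorem residual_eq {n d : ℕ} {X : Fin n → Fin d → ℝ} (hrank : (Matrix.of X).rank = d)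
    (β : Fin d → ℝ) {y : Fin n → ℝ} (hy : isSign y) :
    ∑ i, (X i ⬝ᵥ β - y i) ^ 2 =
      n - y ⬝ᵥ (Hmat X *ᵥ y) + ∑ i, (X i ⬝ᵥ β - (Hmat X *ᵥ y) i) ^ 2 := by
  have hsq (a b : Fin n → ℝ) : ∑ i, (a i - b i) ^ 2 = a ⬝ᵥ a - 2 * (a ⬝ᵥ b) + b ⬝ᵥ b := by
    simp only [dotProduct, Finset.mul_sum, ← Finset.sum_sub_distrib, ← Finset.sum_add_distrib]
    exact Finset.sum_congr rfl fun i _ => by ring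
  have hyy : y ⬝ᵥ y = n := by
    have h1 : ∀ i, y i * y i = 1 := fun i => by rcases hy i with h | h <;> rw [h] <;> norm_num
    simp [dotProduct, h1]
  have hβ := mulVec_dotProduct_Hmat_mulVec hrank β y
  have hH := mulVec_dotProduct_Hmat_mulVec hrank (leastSquares X y) y
  rw [mulVec_leastSquares, dotProduct_comm _ y] at hH
  have e1 := hsq (Matrix.of X *ᵥ β) y
  have e2 := hsq (Matrix.of X *ᵥ β) (Hmat X *ᵥ y)
  change ∑ i, ((Matrix.of X *ᵥ β) i - y i) ^ 2 =
    n - y ⬝ᵥ (Hmat X *ᵥ y) + ∑ i, ((Matrix.of X *ᵥ β) i - (Hmat X *ᵥ y) i) ^ 2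
  linarith

theorem le_residual {n d : ℕ} {X : Fin n → Fin d → ℝ} (hrank : (Matrix.of X).rank = d)
    (β : Fin d → ℝ) {y : Fin n → ℝ} (hy : isSign y) :
    n - y ⬝ᵥ (Hmat X *ᵥ y) ≤ ∑ i, (X i ⬝ᵥ β - y i) ^ 2 := by
  rw [residual_eq hrank β hy]
  exact le_add_of_nonneg_right (Finset.sum_nonneg fun i _ => sq_nonneg _)

theorem ppObj_le_residual {n d : ℕ} (X : Fin n → Fin d → ℝ) (β : Fin d → ℝ)
    {y : Fin n → ℝ} (hy : isSign y) : ppObj X β ≤ ∑ i, (X i ⬝ᵥ β - y i) ^ 2 := by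
  refine Finset.sum_le_sum fun i _ => ?_
  have h1 := le_abs_self (X i ⬝ᵥ β)
  have h2 := neg_abs_le (X i ⬝ᵥ β)
  have h3 := sq_abs (X i ⬝ᵥ β)
  rcases hy i with h | h <;> rw [h] <;> nlinarith

theorem ppObj_leastSquares_le {n d : ℕ} {X : Fin n → Fin d → ℝ}
    (hrank : (Matrix.of X).rank = d) {y : Fin n → ℝ} (hy : isSign y) :
    ppObj X (leastSquares X y) ≤ n - y ⬝ᵥ (Hmat X *ᵥ y) := by
  have h := residual_eq hrank (leastSquares X y) hy
  have h0 (i : Fin n) : X i ⬝ᵥ leastSquares X y = (Hmat X *ᵥ y) i :=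
    congrFun (mulVec_leastSquares X y) i
  have h1 : ∑ i, (X i ⬝ᵥ leastSquares X y - (Hmat X *ᵥ y) i) ^ 2 = 0 := by simp [h0]
  linarith [ppObj_le_residual X (leastSquares X y) hy]

theorem isSign_sgn1 {m : ℕ} (v : Fin m → ℝ) : isSign fun i => sgn1 (v i) := fun i => by
  change sgn1 (v i) = 1 ∨ sgn1 (v i) = -1
  unfold sgn1
  split_ifs <;> simp

theorem isSign.neg {m : ℕ} {v : Fin m → ℝ} (hv : isSign v) : isSign (-v) := fun i => by
  rcases hv i with h | h <;> simp [h]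

theorem ppObj_eq_residual_sgn1 {n d : ℕ} (X : Fin n → Fin d → ℝ) (β : Fin d → ℝ) :
    ppObj X β = ∑ i, (X i ⬝ᵥ β - sgn1 ((Matrix.of X *ᵥ β) i)) ^ 2 := by
  refine Finset.sum_congr rfl fun i _ => ?_
  change _ = (X i ⬝ᵥ β - sgn1 (X i ⬝ᵥ β)) ^ 2
  unfold sgn1
  split_ifs with h
  · rw [abs_of_nonneg h]
  · rw [abs_of_neg (not_le.mp h)]
    ring

theorem le_ppObj {n d : ℕ} {X : Fin n → Fin d → ℝ} (hrank : (Matrix.of X).rank = d)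
    (β : Fin d → ℝ) :
    n - (fun i => sgn1 ((Matrix.of X *ᵥ β) i)) ⬝ᵥ
      (Hmat X *ᵥ fun i => sgn1 ((Matrix.of X *ᵥ β) i)) ≤ ppObj X β := by
  rw [ppObj_eq_residual_sgn1]
  exact le_residual hrank β (isSign_sgn1 _)

theorem ppObj_neg {n d : ℕ} (X : Fin n → Fin d → ℝ) (β : Fin d → ℝ) :
    ppObj X (-β) = ppObj X β := by
  simp [ppObj]

/-- equivalence between the uncoupled linear regression (projection pursuit)
program `min_β ∑ᵢ(|βᵀxᵢ|-1)²` and the Max-Cut program `max_{y ∈ {±1}ⁿ} yᵀHy`. -/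
theorem projection_pursuit_maxcut_equivalence {n d : ℕ} (hn : 1 ≤ n) (hd : 1 ≤ d)
    (X : Fin n → Fin d → ℝ) (hrank : (Matrix.of X).rank = d) :
    (∀ βhat : Fin d → ℝ, (∀ β : Fin d → ℝ, ppObj X βhat ≤ ppObj X β) →
      ∀ s : Fin n → ℝ,
        (s = fun i => sgn1 ((Matrix.of X *ᵥ βhat) i)) ∨
          (s = fun i => -sgn1 ((Matrix.of X *ᵥ βhat) i)) →
        isSign s ∧ ∀ y : Fin n → ℝ, isSign y → y ⬝ᵥ (Hmat X *ᵥ y) ≤ s ⬝ᵥ (Hmat X *ᵥ s)) ∧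
    (∀ yhat : Fin n → ℝ, isSign yhat →
      (∀ y : Fin n → ℝ, isSign y → y ⬝ᵥ (Hmat X *ᵥ y) ≤ yhat ⬝ᵥ (Hmat X *ᵥ yhat)) →
      ∀ β : Fin d → ℝ,
        (β = ((Matrix.of X)ᵀ * Matrix.of X)⁻¹ *ᵥ ((Matrix.of X)ᵀ *ᵥ yhat)) ∨
          (β = -(((Matrix.of X)ᵀ * Matrix.of X)⁻¹ *ᵥ ((Matrix.of X)ᵀ *ᵥ yhat))) →
        ∀ β' : Fin d → ℝ, ppObj X β ≤ ppObj X β') := by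
  constructor
  · intro βhat hmin s hs
    set σ : Fin n → ℝ := fun i => sgn1 ((Matrix.of X *ᵥ βhat) i)
    have hσs : isSign σ := isSign_sgn1 _
    have hmax (y : Fin n → ℝ) (hy : isSign y) : y ⬝ᵥ (Hmat X *ᵥ y) ≤ σ ⬝ᵥ (Hmat X *ᵥ σ) := by
      linarith [ppObj_leastSquares_le hrank hy, hmin (leastSquares X y), le_ppObj hrank βhat]
    rcases hs with rfl | hs
    · exact ⟨hσs, hmax⟩
    · obtain rfl : s = -σ := hs
      refine ⟨hσs.neg, fun y hy => ?_⟩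
      rw [Matrix.mulVec_neg, neg_dotProduct_neg]
      exact hmax y hy
  · intro yhat hy hmax β hβ β'
    have hmin : ppObj X (leastSquares X yhat) ≤ ppObj X β' := by
      linarith [ppObj_leastSquares_le hrank hy, le_ppObj hrank β',
        hmax _ (isSign_sgn1 (Matrix.of X *ᵥ β'))]
    rcases hβ with rfl | rfl
    · exact hmin
    · rw [ppObj_neg]
      exact hmin
end
end

section
/- Let K ≥ 1, let y^{(1)}, y^{(2)} ∈ [K]^n, and let n_min = min_{l ∈ [K]} |{i ∈ [n] : y_i^{(2)} = l}|. Suppose τ is a permutation of [K] with E := |{i ∈ [n] : y_i^{(1)} ≠ τ(y_i^{(2)})}| ≤ n_min / 2. Then for every permutation σ of [K] with σ ≠ τ, |{i ∈ [n] : y_i^{(1)} ≠ σ(y_i^{(2)})}| ≥ |{i ∈ [n] : y_i^{(1)} ≠ τ(y_i^{(2)})}| + (n_min − 2E). Consequently, if E < n_min / 2, then τ is the unique minimizer over permutations η of [K] of L(η) = |{i ∈ [n] : y_i^{(1)} ≠ η(y_i^{(2)})}|. -/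
noncomputable section

/-- If `f ≠ g` somewhere on the range of labels, every index carrying that label is a mismatch for
`f` or for `g`, so the smallest label class is at most the total number of mismatches. -/
theorem iInf_card_fiber_le_card_ne_add_card_ne {ι α β : Type*} [Finite ι]
    (u : ι → β) (v : ι → α) {f g : α → β} (hfg : f ≠ g) :
    ⨅ l, Nat.card {i // v i = l} ≤
      Nat.card {i // u i ≠ f (v i)} + Nat.card {i // u i ≠ g (v i)} := by
  obtain ⟨l, hl⟩ := Function.ne_iff.mp hfg
  calc ⨅ l, Nat.card {i // v i = l}
      ≤ Nat.card {i // v i = l} := ciInf_le (OrderBot.bddBelow _) l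
    _ = {i | v i = l}.ncard := rfl
    _ ≤ ({i | u i ≠ f (v i)} ∪ {i | u i ≠ g (v i)}).ncard := by
      refine Set.ncard_le_ncard (fun i (hi : v i = l) => ?_) (Set.toFinite _)
      by_contra h
      simp only [Set.mem_union, Set.mem_ofPred_eq, not_or, not_not, hi] at h
      exact hl (h.1.symm.trans h.2)
    _ ≤ {i | u i ≠ f (v i)}.ncard + {i | u i ≠ g (v i)}.ncard := Set.ncard_union_le _ _

/-- stability of label alignment.  With
`E = #{i : y¹ᵢ ≠ τ(y²ᵢ)} ≤ n_min/2`, every other permutation `σ` mismatches at least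
`E + (n_min - 2E)` labels; consequently, if `E < n_min/2`, then `τ` is the unique
minimizer of `η ↦ #{i : y¹ᵢ ≠ η(y²ᵢ)}` over permutations of `[K]`. -/
theorem alignment_uniqueness {n K : ℕ} (hK : 1 ≤ K)
    (y1 y2 : Fin n → Fin K) (τ : Equiv.Perm (Fin K))
    (hE : 2 * Nat.card {i : Fin n // y1 i ≠ τ (y2 i)} ≤
      ⨅ l, Nat.card {i : Fin n // y2 i = l}) :
    (∀ σ : Equiv.Perm (Fin K), σ ≠ τ →
      Nat.card {i : Fin n // y1 i ≠ τ (y2 i)} +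
          ((⨅ l, Nat.card {i : Fin n // y2 i = l}) -
            2 * Nat.card {i : Fin n // y1 i ≠ τ (y2 i)}) ≤
        Nat.card {i : Fin n // y1 i ≠ σ (y2 i)}) ∧
    (2 * Nat.card {i : Fin n // y1 i ≠ τ (y2 i)} <
        ⨅ l, Nat.card {i : Fin n // y2 i = l} →
      ∀ σ : Equiv.Perm (Fin K), σ ≠ τ →
        Nat.card {i : Fin n // y1 i ≠ τ (y2 i)} <
          Nat.card {i : Fin n // y1 i ≠ σ (y2 i)}) := by
  have key (σ : Equiv.Perm (Fin K)) (hσ : σ ≠ τ) :=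
    iInf_card_fiber_le_card_ne_add_card_ne y1 y2 (DFunLike.coe_injective.ne hσ.symm)
  refine ⟨fun σ hσ => ?_, fun hlt σ hσ => ?_⟩ <;>
  · have := key σ hσ
    omega
end
end

section
/- Let X be a real random variable with E[X] = 0, E[X²] = 1, and finite sub-Gaussian norm ‖X‖_{ψ₂} = σ, where ‖X‖_{ψ₂} := sup_{p ≥ 1} p^{−1/2} (E|X|^p)^{1/p}. Then there exists R₀ > 0, depending only on σ, such that for every R > R₀, P(X > 1/(16 R σ)) ≥ 1/(16 R² σ²) and P(X < −1/(16 R σ)) ≥ 1/(16 R² σ²). -/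
open MeasureTheory Real

noncomputable section

/-- A Paley–Zygmund type bound: a centered variable of unit variance whose first absolute moment
is at least `2 * c` exceeds each level `a ≤ c / 6` with probability at least `16 * a ^ 2`. -/
theorem sixteen_mul_sq_le_measureReal_lt {Ω : Type*} [MeasurableSpace Ω] {μ : Measure Ω}
    [IsProbabilityMeasure μ] {X : Ω → ℝ} (hX : Measurable X) (hint : Integrable X μ)
    (hint2 : Integrable (fun ω => X ω ^ 2) μ) (hmean : ∫ ω, X ω ∂μ = 0)
    (hvar : ∫ ω, X ω ^ 2 ∂μ = 1) {a c : ℝ} (hc : 0 < c) (ha : 0 ≤ a) (hac : a ≤ c / 6)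
    (habs : 2 * c ≤ ∫ ω, |X ω| ∂μ) :
    16 * a ^ 2 ≤ μ.real {ω | a < X ω} := by
  have hS : MeasurableSet {ω | a < X ω} := measurableSet_lt measurable_const hX
  have hind : Integrable ({ω | a < X ω}.indicator (1 : Ω → ℝ)) μ :=
    (integrable_const (1 : ℝ)).indicator hS
  have hpoint : ∀ ω, c * X ω + c * |X ω| ≤
      2 * a * c + c ^ 2 * X ω ^ 2 + {ω | a < X ω}.indicator (1 : Ω → ℝ) ω := by
    intro ω
    by_cases h : a < X ω
    · rw [Set.indicator_of_mem (show ω ∈ {ω | a < X ω} from h), Pi.one_apply,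
        abs_of_pos (ha.trans_lt h)]
      nlinarith [sq_nonneg (c * X ω - 1), mul_nonneg ha hc.le]
    · rw [Set.indicator_of_notMem (show ω ∉ {ω | a < X ω} from h)]
      have hXa : X ω + |X ω| ≤ 2 * a := by
        rcases abs_cases (X ω) with h' | h' <;> linarith [not_lt.mp h]
      nlinarith [mul_le_mul_of_nonneg_left hXa hc.le, sq_nonneg (c * X ω)]
  have hquad : Integrable (fun ω => 2 * a * c + c ^ 2 * X ω ^ 2) μ :=
    (integrable_const (2 * a * c)).add (hint2.const_mul (c ^ 2))
  have hle := integral_mono (μ := μ) ((hint.const_mul c).add (hint.abs.const_mul c))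
    (hquad.add hind) hpoint
  simp only [Pi.add_apply] at hle
  rw [integral_add (hint.const_mul c) (hint.abs.const_mul c),
    integral_add hquad hind,
    integral_add (integrable_const (2 * a * c)) (hint2.const_mul (c ^ 2)),
    integral_const, probReal_univ, one_smul, integral_const_mul, integral_const_mul,
    integral_const_mul, integral_indicator_one hS, hmean, hvar] at hle
  nlinarith [mul_le_mul_of_nonneg_left habs hc.le, mul_le_mul_of_nonneg_left hac hc.le,
    mul_le_mul_of_nonneg_left hac ha]

/-- A lower bound on the first absolute moment from the second and fourth moments. -/
theorem le_integral_abs_of_fourth_moment {Ω : Type*} [MeasurableSpace Ω] {μ : Measure Ω}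
    {X : Ω → ℝ} (hint : Integrable X μ) (hint2 : Integrable (fun ω => X ω ^ 2) μ)
    (hint4 : Integrable (fun ω => X ω ^ 4) μ) {t : ℝ} (ht : 0 < t) :
    ∫ ω, X ω ^ 2 ∂μ ≤ t * ∫ ω, |X ω| ∂μ + (t ^ 2)⁻¹ * ∫ ω, X ω ^ 4 ∂μ := by
  rw [← integral_const_mul, ← integral_const_mul,
    ← integral_add (hint.abs.const_mul t) (hint4.const_mul _)]
  refine integral_mono hint2 ((hint.abs.const_mul t).add (hint4.const_mul _)) fun ω => ?_
  simp only
  have h4 : X ω ^ 4 = |X ω| ^ 4 := (Even.pow_abs (by decide) _).symm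
  rw [← sq_abs, h4]
  have hx := abs_nonneg (X ω)
  generalize |X ω| = x at hx
  rcases le_total x t with h | h
  · have : 0 ≤ (t ^ 2)⁻¹ * x ^ 4 := by positivity
    nlinarith [mul_le_mul_of_nonneg_right h hx]
  · have hsq : t ^ 2 ≤ x ^ 2 := by gcongr
    have : x ^ 2 ≤ (t ^ 2)⁻¹ * x ^ 4 := by
      rw [inv_mul_eq_div, le_div_iff₀ (by positivity)]
      nlinarith [mul_le_mul_of_nonneg_left hsq (sq_nonneg x)]
    nlinarith [mul_nonneg ht.le hx]

/-- anti-concentration of normalized sub-Gaussian random variables.  For a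
random variable `X` with `E X = 0`, `E X² = 1`, and sub-Gaussian norm
`‖X‖_{ψ₂} = sup_{p ≥ 1} p^{-1/2}(E|X|^p)^{1/p} = σ` (expressed by the `IsLUB` hypothesis),
there exists `R₀ > 0` depending only on `σ` such that for all `R > R₀` both tails
`P(X > 1/(16Rσ))` and `P(X < -1/(16Rσ))` are at least `1/(16R²σ²)`. -/
theorem subgaussian_anticoncentration (σ : ℝ) :
    ∃ R₀ : ℝ, 0 < R₀ ∧
      ∀ (Ω : Type) [MeasureSpace Ω] [IsProbabilityMeasure (volume : Measure Ω)]
        (X : Ω → ℝ), Measurable X →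
        (∀ p : ℝ, 1 ≤ p → Integrable (fun ω => |X ω| ^ p)) →
        (∫ ω, X ω) = 0 → (∫ ω, (X ω) ^ 2) = 1 →
        IsLUB {r : ℝ | ∃ p : ℝ, 1 ≤ p ∧
          r = p ^ (-(1 : ℝ) / 2) * (∫ ω, |X ω| ^ p) ^ (1 / p)} σ →
        ∀ R : ℝ, R₀ < R →
          1 / (16 * R ^ 2 * σ ^ 2) ≤ (volume {ω | 1 / (16 * R * σ) < X ω}).toReal ∧
          1 / (16 * R ^ 2 * σ ^ 2) ≤ (volume {ω | X ω < -(1 / (16 * R * σ))}).toReal := by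
  refine ⟨9 * |σ| + 1, by positivity, ?_⟩
  intro Ω _ _ X hX hint hmean hvar hlub R hR
  have hrpow2 : ∀ ω, |X ω| ^ (2 : ℝ) = X ω ^ 2 := fun ω => by
    rw [Real.rpow_ofNat, sq_abs]
  have hrpow4 : ∀ ω, |X ω| ^ (4 : ℝ) = X ω ^ 4 := fun ω => by
    rw [Real.rpow_ofNat, Even.pow_abs (by decide)]
  have hint1 : Integrable X := by
    have h := hint 1 le_rfl
    simp only [Real.rpow_one] at h
    exact (integrable_norm_iff hX.aestronglyMeasurable).mp h
  have hint2 : Integrable (fun ω => X ω ^ 2) := by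
    simpa only [hrpow2] using hint 2 (by norm_num)
  have hint4 : Integrable (fun ω => X ω ^ 4) := by
    simpa only [hrpow4] using hint 4 (by norm_num)
  have hσ : 0 < σ := by
    have h := hlub.1 ⟨2, by norm_num, rfl⟩
    simp only [hrpow2, hvar, Real.one_rpow, mul_one] at h
    exact lt_of_lt_of_le (by positivity) h
  have hfourth : ∫ ω, X ω ^ 4 ≤ 16 * σ ^ 4 := by
    have h := hlub.1 ⟨4, by norm_num, rfl⟩
    simp only [hrpow4] at h
    have hI : 0 ≤ ∫ ω, X ω ^ 4 := integral_nonneg fun ω => by positivity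
    have hhalf : (4 : ℝ) ^ (-(1 : ℝ) / 2) = 1 / 2 := by
      rw [show (4 : ℝ) = 2 ^ (2 : ℝ) by norm_num, ← Real.rpow_mul (by norm_num)]
      norm_num [Real.rpow_neg_one]
    rw [hhalf] at h
    have hroot : (∫ ω, X ω ^ 4) ^ (1 / 4 : ℝ) ≤ 2 * σ := by linarith
    calc ∫ ω, X ω ^ 4 = ((∫ ω, X ω ^ 4) ^ (1 / 4 : ℝ)) ^ 4 := by
          rw [← Real.rpow_mul_natCast hI]; norm_num
      _ ≤ (2 * σ) ^ 4 := by gcongr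
      _ = 16 * σ ^ 4 := by ring
  have habs : 2 * (1 / (24 * σ ^ 2)) ≤ ∫ ω, |X ω| := by
    have h := le_integral_abs_of_fourth_moment hint1 hint2 hint4
      (t := 6 * σ ^ 2) (by positivity)
    have hbound : ((6 * σ ^ 2) ^ 2)⁻¹ * ∫ ω, X ω ^ 4 ≤ 4 / 9 := by
      rw [inv_mul_eq_div, div_le_iff₀ (by positivity)]
      linarith
    rw [hvar] at h
    rw [mul_one_div, div_le_iff₀ (by positivity)]
    linarith
  rw [abs_of_pos hσ] at hR
  have hR0 : 0 < R := by linarith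
  have hlevel : 1 / (16 * R * σ) ≤ 1 / (24 * σ ^ 2) / 6 := by
    rw [div_div]
    refine one_div_le_one_div_of_le (by positivity) ?_
    nlinarith
  have hsq : 1 / (16 * R ^ 2 * σ ^ 2) = 16 * (1 / (16 * R * σ)) ^ 2 := by
    field_simp
  rw [hsq]
  constructor
  · exact sixteen_mul_sq_le_measureReal_lt hX hint1 hint2 hmean hvar
      (by positivity) (by positivity) hlevel habs
  · have h := sixteen_mul_sq_le_measureReal_lt (X := fun ω => -X ω) hX.neg hint1.neg
      (by simpa only [neg_sq] using hint2) (by rw [integral_neg, hmean, neg_zero])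
      (by simpa only [neg_sq] using hvar) (by positivity) (by positivity) hlevel
      (by simpa only [abs_neg] using habs)
    simpa only [lt_neg, measureReal_def] using h
end
end
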